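/- arXiv:math/9404230 — 2 statements merged into one kernel-verified Lean document; each statement's English description precedes it below -/
import Mathlib

section
/- (Lutwak's theorem.) Let n ≥ 2, let L₁ be a star body in ℝⁿ whose radial function satisfies ρ_{L₁} = Rg for some nonnegative continuous function g on S^{n−1} (i.e., L₁ is the intersection body of some star body), and let L₂ be an arbitrary star body in ℝⁿ such that λ_{n−1}(L₁ ∩ u^⊥) ≤ λ_{n−1}(L₂ ∩ u^⊥) for all u ∈ S^{n−1}. Then λ_n(L₁) ≤ λ_n(L₂). -/
open MeasureTheory Metric
open scoped RealInnerProductSpace ENNReal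

noncomputable section

abbrev E (n : ℕ) := EuclideanSpace ℝ (Fin n)

/-- The radial function of a set: `ρ_K(x) = max {c ≥ 0 : c • x ∈ K}`. -/
def radialFn {n : ℕ} (K : Set (E n)) (x : E n) : ℝ :=
  sSup {c : ℝ | 0 ≤ c ∧ c • x ∈ K}

/-- A convex body: compact convex set with nonempty interior. -/
def IsConvexBody {n : ℕ} (K : Set (E n)) : Prop :=
  IsCompact K ∧ Convex ℝ K ∧ (interior K).Nonempty

/-- Centered: symmetric about the origin. -/
def IsCentered {n : ℕ} (K : Set (E n)) : Prop :=
  ∀ x, x ∈ K ↔ -x ∈ K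

/-- The hyperplane through the origin orthogonal to `u`. -/
def hyperplane {n : ℕ} (u : E n) : Set (E n) := {x | ⟪x, u⟫ = 0}

/-- A star body: compact, star-shaped at the origin (contains the origin), with
continuous radial function on the unit sphere. -/
def IsStarBody {n : ℕ} (L : Set (E n)) : Prop :=
  IsCompact L ∧ (0 : E n) ∈ L ∧ StarConvex ℝ 0 L ∧
    ContinuousOn (radialFn L) (sphere (0 : E n) 1)

/-- `L` is the intersection body of `M`: `ρ_L(u) = λ_{n-1}(M ∩ u^⊥)` for `u ∈ S^{n-1}`. -/
def IsIntersectionBodyOf {n : ℕ} (L M : Set (E n)) : Prop :=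
  ∀ u ∈ sphere (0 : E n) 1,
    radialFn L u = (μH[(n : ℝ) - 1] (M ∩ hyperplane u)).toReal

/-- The spherical Radon transform:
`(Rg)(u) = ∫_{S^{n-1} ∩ u^⊥} g dλ_{n-2}`. -/
def radon (n : ℕ) (g : E n → ℝ) (u : E n) : ℝ :=
  ∫ v in (sphere (0 : E n) 1 ∩ hyperplane u), g v ∂μH[(n : ℝ) - 2]

/-- A function on the sphere is C^∞ if its 0-homogeneous extension is smooth
away from the origin. -/
def SmoothOnSphere {n : ℕ} (h : E n → ℝ) : Prop :=
  ContDiffOn ℝ (⊤ : ℕ∞) (fun x : E n => h (‖x‖⁻¹ • x)) {(0 : E n)}ᶜ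

/-- A body of revolution about the axis `u₀`: invariant under every (linear)
isometry of `ℝⁿ` fixing `u₀`. -/
def IsRevolutionBody {n : ℕ} (u₀ : E n) (K : Set (E n)) : Prop :=
  ∀ f : E n ≃ₗᵢ[ℝ] E n, f u₀ = u₀ → f '' K = K

open Set Filter Topology

section UniformlyDistributed

variable {α : Type*} [PseudoMetricSpace α] [SecondCountableTopology α] [MeasurableSpace α]
  [BorelSpace α]

/-- One half of the uniqueness of uniformly distributed measures, on open sets. -/
lemma measure_isOpen_mul_le_of_ball_eq {X : Set α} (hX : IsCompact X) {μ ν : Measure α}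
    [IsFiniteMeasure μ] [IsFiniteMeasure ν] (hμX : ∀ᵐ x ∂μ, x ∈ X) (hνX : ∀ᵐ x ∂ν, x ∈ X)
    (hμ : ∀ r, ∀ x ∈ X, ∀ y ∈ X, μ (ball x r) = μ (ball y r))
    (hν : ∀ r, ∀ x ∈ X, ∀ y ∈ X, ν (ball x r) = ν (ball y r))
    {U : Set α} (hU : IsOpen U) : μ U * ν univ ≤ ν U * μ univ := by
  by_cases hμz : μ univ = 0
  · have : μ U = 0 := measure_mono_null (subset_univ _) hμz
    simp [this]
  obtain ⟨x₀, hx₀⟩ : X.Nonempty := by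
    by_contra h
    rw [not_nonempty_iff_eq_empty] at h
    subst h
    apply hμz
    simpa [ae_iff] using hμX
  -- the key double counting inequality
  have key : ∀ A B : Set α, IsOpen B → ∀ r > 0, MeasurableSet A → (∀ x ∈ A, ball x r ⊆ B) →
      μ A * ν (ball x₀ r) ≤ ν B * μ (ball x₀ r) := by
    intro A B hB r hr hA hAB
    have hmeas : MeasurableSet {p : α × α | p.1 ∈ A ∧ dist p.1 p.2 < r} :=
      (measurable_fst hA).inter (isOpen_lt continuous_dist continuous_const).measurableSet
    have hmeas' : MeasurableSet {p : α × α | p.2 ∈ B ∧ dist p.1 p.2 < r} :=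
      (measurable_snd hB.measurableSet).inter
        (isOpen_lt continuous_dist continuous_const).measurableSet
    calc μ A * ν (ball x₀ r) = ∫⁻ x in A, ν (ball x₀ r) ∂μ := by
          rw [setLIntegral_const, mul_comm]
      _ = ∫⁻ x in A, ν (ball x r) ∂μ := by
          refine lintegral_congr_ae ?_
          filter_upwards [ae_restrict_of_ae hμX] with x hx using hν r _ hx₀ _ hx
      _ ≤ (μ.prod ν) {p : α × α | p.1 ∈ A ∧ dist p.1 p.2 < r} := by
          rw [Measure.prod_apply hmeas, ← lintegral_indicator hA]
          refine lintegral_mono fun x => ?_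
          by_cases hx : x ∈ A
          · rw [indicator_of_mem hx]
            refine measure_mono fun y hy => ⟨hx, ?_⟩
            rw [mem_ball, dist_comm] at hy
            exact hy
          · simp [hx]
      _ ≤ (μ.prod ν) {p : α × α | p.2 ∈ B ∧ dist p.1 p.2 < r} := by
          refine measure_mono fun p hp => ⟨hAB _ hp.1 ?_, hp.2⟩
          rw [mem_ball, dist_comm]
          exact hp.2
      _ ≤ ∫⁻ y in B, μ (ball y r) ∂ν := by
          rw [Measure.prod_apply_symm hmeas', ← lintegral_indicator hB.measurableSet]
          refine lintegral_mono fun y => ?_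
          by_cases hy : y ∈ B
          · rw [indicator_of_mem hy]
            exact measure_mono fun x hx => hx.2
          · simp [hy]
      _ = ∫⁻ y in B, μ (ball x₀ r) ∂ν := by
          refine lintegral_congr_ae ?_
          filter_upwards [ae_restrict_of_ae hνX] with y hy using hμ r _ hy _ hx₀
      _ = ν B * μ (ball x₀ r) := by
          rw [setLIntegral_const, mul_comm]
  have key' : ∀ r > 0, ν univ * μ (ball x₀ r) ≤ μ univ * ν (ball x₀ r) := by
    intro r hr
    have hmeas : MeasurableSet {p : α × α | dist p.1 p.2 < r} :=
      (isOpen_lt continuous_dist continuous_const).measurableSet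
    have h1 : (μ.prod ν) {p : α × α | dist p.1 p.2 < r} = μ univ * ν (ball x₀ r) := by
      rw [Measure.prod_apply hmeas, mul_comm, ← lintegral_const]
      refine lintegral_congr_ae ?_
      filter_upwards [hμX] with x hx
      rw [hν r _ hx₀ _ hx]
      congr 1
      ext y
      simp [dist_comm]
    have h2 : (μ.prod ν) {p : α × α | dist p.1 p.2 < r} = ν univ * μ (ball x₀ r) := by
      rw [Measure.prod_apply_symm hmeas, mul_comm, ← lintegral_const]
      refine lintegral_congr_ae ?_
      filter_upwards [hνX] with x hx
      rw [hμ r _ hx₀ _ hx]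
      congr 1
    rw [← h1, ← h2]
  have hpos : ∀ r > 0, μ (ball x₀ r) ≠ 0 := by
    intro r hr h0
    obtain ⟨t, htX, htf, hcov⟩ := hX.finite_cover_balls hr
    apply hμz
    have hX0 : μ X = 0 := by
      refine measure_mono_null hcov ((measure_biUnion_null_iff htf.countable).2 fun x hx => ?_)
      rw [hμ r x (htX hx) x₀ hx₀, h0]
    refine measure_mono_null (t := X ∪ Xᶜ) (by simp) ?_
    rw [measure_union_null_iff]
    exact ⟨hX0, hμX⟩
  have hle : ∀ r > 0, ∀ A : Set α, MeasurableSet A → (∀ x ∈ A, ball x r ⊆ U) →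
      μ A * ν univ ≤ ν U * μ univ := by
    intro r hr A hA hAU
    refine (ENNReal.mul_le_mul_iff_left (hpos r hr) (measure_ne_top _ _)).1 ?_
    calc μ A * ν univ * μ (ball x₀ r) = μ A * (ν univ * μ (ball x₀ r)) := by ring
      _ ≤ μ A * (μ univ * ν (ball x₀ r)) := mul_le_mul' le_rfl (key' r hr)
      _ = (μ A * ν (ball x₀ r)) * μ univ := by ring
      _ ≤ (ν U * μ (ball x₀ r)) * μ univ := mul_le_mul' (key A U hU r hr hA hAU) le_rfl
      _ = ν U * μ univ * μ (ball x₀ r) := by ring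
  let F : ℕ → Set α := fun k => {x | ENNReal.ofReal (1 / ((k : ℝ) + 1)) ≤ infEDist x Uᶜ}
  have hFm : ∀ k, MeasurableSet (F k) := fun k =>
    (isClosed_le continuous_const continuous_infEDist).measurableSet
  have hFU : ∀ k, ∀ x ∈ F k, ball x (1 / ((k : ℝ) + 1)) ⊆ U := by
    intro k x hx y hy
    by_contra hyU
    have h1 : infEDist x Uᶜ ≤ edist x y := infEDist_le_edist_of_mem hyU
    have h2 : edist x y < ENNReal.ofReal (1 / ((k : ℝ) + 1)) := by
      rw [edist_dist, ENNReal.ofReal_lt_ofReal_iff (by positivity), dist_comm]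
      exact hy
    exact absurd (hx.trans h1) (not_le.2 h2)
  have hFmono : Monotone F := by
    intro k l hkl x hx
    refine le_trans (ENNReal.ofReal_le_ofReal ?_) hx
    have : (k : ℝ) ≤ l := by exact_mod_cast hkl
    gcongr
  have hFunion : U = ⋃ k, F k := by
    ext x
    rw [mem_iUnion]
    constructor
    · intro hx
      obtain ⟨ε, hε, hxε⟩ := Metric.isOpen_iff.1 hU x hx
      obtain ⟨k, hk⟩ := exists_nat_one_div_lt hε
      refine ⟨k, le_infEDist.2 fun y hy => ?_⟩
      rw [edist_dist]
      refine ENNReal.ofReal_le_ofReal (hk.le.trans ?_)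
      by_contra hlt
      rw [not_le, dist_comm] at hlt
      exact hy (hxε hlt)
    · rintro ⟨k, hk⟩
      exact hFU k x hk (mem_ball_self (by positivity))
  conv_lhs => rw [hFunion]
  rw [hFmono.measure_iUnion, ENNReal.iSup_mul]
  exact iSup_le fun k => hle _ (by positivity) _ (hFm k) (hFU k)

/-- Uniqueness, up to normalization, of a uniformly distributed measure on a compact set. -/
lemma smul_eq_smul_of_ball_eq {X : Set α} (hX : IsCompact X) {μ ν : Measure α}
    [IsFiniteMeasure μ] [IsFiniteMeasure ν] (hμX : ∀ᵐ x ∂μ, x ∈ X) (hνX : ∀ᵐ x ∂ν, x ∈ X)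
    (hμ : ∀ r, ∀ x ∈ X, ∀ y ∈ X, μ (ball x r) = μ (ball y r))
    (hν : ∀ r, ∀ x ∈ X, ∀ y ∈ X, ν (ball x r) = ν (ball y r)) :
    ν univ • μ = μ univ • ν := by
  have := μ.smul_finite (measure_ne_top ν univ)
  refine ext_of_generate_finite _ (BorelSpace.measurable_eq (α := α)) isPiSystem_isOpen ?_ ?_
  · intro U hU
    have h1 := measure_isOpen_mul_le_of_ball_eq hX hμX hνX hμ hν hU
    have h2 := measure_isOpen_mul_le_of_ball_eq hX hνX hμX hν hμ hU
    simp only [Measure.smul_apply, smul_eq_mul]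
    rw [mul_comm, mul_comm (μ univ)]
    exact le_antisymm h1 h2
  · simp [mul_comm]

end UniformlyDistributed

section SphereMeasures

variable {n : ℕ}

/-- The radial projection onto the unit sphere. -/
def unitize (x : E n) : E n := ‖x‖⁻¹ • x

/-- The orthogonal projection along the unit vector `u`. -/
def projPerp (u x : E n) : E n := x - ⟪x, u⟫ • u

/-- Lebesgue measure on the open unit ball. -/
def ballMeasure (n : ℕ) : Measure (E n) := volume.restrict (ball 0 1)

/-- The cone measure on the unit sphere. -/
def coneMeasure (n : ℕ) : Measure (E n) := (ballMeasure n).map unitize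

/-- A rotation invariant measure on the great subsphere orthogonal to `u`. -/
def perpMeasure (u : E n) : Measure (E n) := (ballMeasure n).map fun x => unitize (projPerp u x)

/-- A rotation invariant measure on the pairs of orthogonal unit vectors. -/
def flagMeasure (n : ℕ) : Measure (E n × E n) :=
  ((coneMeasure n).prod (ballMeasure n)).map fun p => (p.1, unitize (projPerp p.1 p.2))

lemma measurable_unitize : Measurable (unitize : E n → E n) := by
  unfold unitize
  fun_prop

lemma continuous_projPerp : Continuous fun p : E n × E n => projPerp p.1 p.2 := by
  unfold projPerp
  fun_prop

lemma measurable_unitize_projPerp :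
    Measurable fun p : E n × E n => unitize (projPerp p.1 p.2) :=
  measurable_unitize.comp continuous_projPerp.measurable

lemma measurable_unitize_projPerp_right (u : E n) :
    Measurable fun x : E n => unitize (projPerp u x) :=
  measurable_unitize.comp (f := projPerp u)
    (by unfold projPerp; fun_prop : Continuous (projPerp u)).measurable

lemma unitize_mem_sphere {x : E n} (hx : x ≠ 0) : unitize x ∈ sphere (0 : E n) 1 := by
  simp [unitize, norm_smul, hx]

lemma norm_smul_unitize {x : E n} (hx : x ≠ 0) : ‖x‖ • unitize x = x := by
  simp [unitize, smul_smul, hx]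

lemma unitize_map (Q : E n ≃ₗᵢ[ℝ] E n) (x : E n) : unitize (Q x) = Q (unitize x) := by
  simp [unitize]

lemma projPerp_map (Q : E n ≃ₗᵢ[ℝ] E n) (u x : E n) :
    projPerp (Q u) (Q x) = Q (projPerp u x) := by
  simp [projPerp]

instance : IsFiniteMeasure (ballMeasure n) :=
  ⟨by simpa [ballMeasure] using measure_ball_lt_top⟩

instance : IsFiniteMeasure (coneMeasure n) := by
  unfold coneMeasure; infer_instance

instance (u : E n) : IsFiniteMeasure (perpMeasure u) := by
  unfold perpMeasure; infer_instance

instance : IsFiniteMeasure (flagMeasure n) := by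
  unfold flagMeasure; infer_instance

lemma ballMeasure_univ_ne_zero : ballMeasure n univ ≠ 0 := by
  simpa [ballMeasure] using (measure_ball_pos volume (0 : E n) one_pos).ne'

lemma coneMeasure_univ : coneMeasure n univ = ballMeasure n univ := by
  rw [coneMeasure, Measure.map_apply measurable_unitize .univ, preimage_univ]

lemma perpMeasure_univ (u : E n) : perpMeasure u univ = ballMeasure n univ := by
  rw [perpMeasure, Measure.map_apply (measurable_unitize_projPerp_right u) .univ, preimage_univ]

lemma ballMeasure_map (Q : E n ≃ₗᵢ[ℝ] E n) : (ballMeasure n).map Q = ballMeasure n := by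
  have h := Q.measurePreserving.restrict_preimage (s := ball (0 : E n) 1) measurableSet_ball
  have hb : Q ⁻¹' ball (0 : E n) 1 = ball 0 1 := by
    ext x; simp
  rw [hb] at h
  exact h.map_eq

lemma coneMeasure_map (Q : E n ≃ₗᵢ[ℝ] E n) : (coneMeasure n).map Q = coneMeasure n := by
  have hQ : Measurable Q := Q.continuous.measurable
  conv_rhs => rw [coneMeasure, ← ballMeasure_map Q]
  rw [coneMeasure, Measure.map_map hQ measurable_unitize, Measure.map_map measurable_unitize hQ]
  congr 1
  ext1 x
  exact (unitize_map Q x).symm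

lemma perpMeasure_map (Q : E n ≃ₗᵢ[ℝ] E n) {u : E n} (hu : Q u = u) :
    (perpMeasure u).map Q = perpMeasure u := by
  have hQ : Measurable Q := Q.continuous.measurable
  conv_rhs => rw [perpMeasure, ← ballMeasure_map Q]
  rw [perpMeasure, Measure.map_map hQ (measurable_unitize_projPerp_right u),
    Measure.map_map (measurable_unitize_projPerp_right u) hQ]
  congr 1
  ext1 x
  simp only [Function.comp_apply]
  conv_rhs => rw [← hu]
  rw [projPerp_map, unitize_map]

lemma measurable_flag :
    Measurable fun p : E n × E n => (p.1, unitize (projPerp p.1 p.2)) :=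
  measurable_fst.prodMk measurable_unitize_projPerp

lemma flagMeasure_map (Q : E n ≃ₗᵢ[ℝ] E n) :
    (flagMeasure n).map (Prod.map Q Q) = flagMeasure n := by
  have hQ : Measurable Q := Q.continuous.measurable
  have hQQ : Measurable (Prod.map Q Q) := hQ.prodMap hQ
  have h : ((coneMeasure n).prod (ballMeasure n)).map (Prod.map Q Q)
      = (coneMeasure n).prod (ballMeasure n) := by
    rw [← Measure.map_prod_map _ _ hQ hQ, coneMeasure_map, ballMeasure_map]
  conv_rhs => rw [flagMeasure, ← h]
  rw [flagMeasure, Measure.map_map hQQ measurable_flag, Measure.map_map measurable_flag hQQ]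
  congr 1
  ext1 p
  simp [projPerp_map, unitize_map]

lemma lintegral_flagMeasure {F : E n × E n → ℝ≥0∞} (hF : Measurable F) :
    ∫⁻ p, F p ∂flagMeasure n = ∫⁻ u, ∫⁻ v, F (u, v) ∂perpMeasure u ∂coneMeasure n := by
  rw [flagMeasure, lintegral_map hF measurable_flag,
    lintegral_prod (fun p : E n × E n => F (p.1, unitize (projPerp p.1 p.2)))
      (hF.comp measurable_flag).aemeasurable]
  refine lintegral_congr fun u => ?_
  rw [perpMeasure, lintegral_map (f := fun v => F (u, v)) (by fun_prop)
    (measurable_unitize_projPerp_right u)]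

lemma measurable_lintegral_perpMeasure {f : E n → ℝ≥0∞} (hf : Measurable f) :
    Measurable fun u : E n => ∫⁻ v, f v ∂perpMeasure u := by
  simp only [perpMeasure, lintegral_map hf (measurable_unitize_projPerp_right _)]
  exact (hf.comp measurable_unitize_projPerp).lintegral_prod_right'

lemma flagMeasure_univ :
    flagMeasure n univ = ballMeasure n univ * ballMeasure n univ := by
  rw [flagMeasure, Measure.map_apply measurable_flag .univ, preimage_univ, ← univ_prod_univ,
    Measure.prod_prod, coneMeasure_univ]

/-- A linear isometry that exchanges two vectors of the same norm and fixes every vector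
orthogonal to both. -/
lemma exists_isometry_swap {x y : E n} (h : ‖x‖ = ‖y‖) :
    ∃ Q : E n ≃ₗᵢ[ℝ] E n, Q x = y ∧ ∀ z, ⟪x, z⟫ = 0 → ⟪y, z⟫ = 0 → Q z = z := by
  refine ⟨Submodule.reflection (ℝ ∙ (x - y))ᗮ, Submodule.reflection_sub h, fun z hx hy => ?_⟩
  rw [Submodule.reflection_eq_self_iff, Submodule.mem_orthogonal_singleton_iff_inner_right,
    inner_sub_left, hx, hy, sub_zero]

lemma ae_map_mem {α β : Type*} [MeasurableSpace α] [MeasurableSpace β] {μ : Measure α}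
    {f : α → β} (hf : Measurable f) {s : Set β} (hs : MeasurableSet s)
    (h : ∀ᵐ x ∂μ, f x ∈ s) : ∀ᵐ y ∂μ.map f, y ∈ s :=
  (ae_map_iff (p := fun y => y ∈ s) hf.aemeasurable hs).2 h

lemma measure_ball_eq_of_map_eq {α : Type*} [PseudoMetricSpace α] [MeasurableSpace α]
    [BorelSpace α] {μ : Measure α} {Q : α → α} (hQ : Isometry Q) (hμ : μ.map Q = μ) (x : α)
    (r : ℝ) : μ (ball (Q x) r) = μ (ball x r) := by
  conv_lhs => rw [← hμ]
  rw [Measure.map_apply hQ.continuous.measurable measurableSet_ball, hQ.preimage_ball]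

lemma ae_ballMeasure_ne_zero (hn : 1 ≤ n) : ∀ᵐ x ∂ballMeasure n, x ≠ 0 := by
  have : NeZero n := ⟨by omega⟩
  exact ae_restrict_of_ae (compl_mem_ae_iff.2 (measure_singleton (0 : E n)))

lemma ae_ballMeasure_projPerp_ne_zero (hn : 2 ≤ n) (u : E n) :
    ∀ᵐ x ∂ballMeasure n, projPerp u x ≠ 0 := by
  refine ae_restrict_of_ae ?_
  rw [ae_iff]
  refine measure_mono_null (t := (ℝ ∙ u : Submodule ℝ (E n))) ?_
    (Measure.addHaar_submodule volume _ ?_)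
  · intro x hx
    simp only [not_not, mem_ofPred_eq, projPerp, sub_eq_zero] at hx
    rw [hx]
    exact Submodule.smul_mem _ _ (Submodule.mem_span_singleton_self u)
  · intro h
    have h1 : Module.finrank ℝ (ℝ ∙ u : Submodule ℝ (E n)) = n := by
      rw [h, finrank_top, finrank_euclideanSpace_fin]
    have h2 := finrank_span_le_card (R := ℝ) ({u} : Set (E n))
    simp at h2
    omega

lemma ae_coneMeasure (hn : 1 ≤ n) : ∀ᵐ x ∂coneMeasure n, x ∈ sphere (0 : E n) 1 := by
  refine ae_map_mem measurable_unitize isClosed_sphere.measurableSet ?_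
  filter_upwards [ae_ballMeasure_ne_zero hn] with x hx using unitize_mem_sphere hx

lemma isClosed_hyperplane (u : E n) : IsClosed (hyperplane u) :=
  isClosed_eq (by fun_prop) continuous_const

lemma isCompact_sphere_inter_hyperplane (u : E n) :
    IsCompact (sphere (0 : E n) 1 ∩ hyperplane u) :=
  (isCompact_sphere _ _).inter_right (isClosed_hyperplane u)

lemma unitize_projPerp_mem {u x : E n} (hu : u ∈ sphere (0 : E n) 1) (hx : projPerp u x ≠ 0) :
    unitize (projPerp u x) ∈ sphere (0 : E n) 1 ∩ hyperplane u := by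
  refine ⟨unitize_mem_sphere hx, ?_⟩
  have hu1 : ‖u‖ = 1 := by simpa using hu
  simp [hyperplane, unitize, projPerp, inner_smul_left, inner_sub_left, hu1]

lemma ae_perpMeasure (hn : 2 ≤ n) {u : E n} (hu : u ∈ sphere (0 : E n) 1) :
    ∀ᵐ x ∂perpMeasure u, x ∈ sphere (0 : E n) 1 ∩ hyperplane u := by
  refine ae_map_mem (measurable_unitize_projPerp_right u)
    (isCompact_sphere_inter_hyperplane u).measurableSet ?_
  filter_upwards [ae_ballMeasure_projPerp_ne_zero hn u] with x hx using unitize_projPerp_mem hu hx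

lemma perpMeasure_ball {u : E n} (r : ℝ) :
    ∀ x ∈ sphere (0 : E n) 1 ∩ hyperplane u, ∀ y ∈ sphere (0 : E n) 1 ∩ hyperplane u,
      perpMeasure u (ball x r) = perpMeasure u (ball y r) := by
  rintro x ⟨hx, hxu⟩ y ⟨hy, hyu⟩
  obtain ⟨Q, rfl, hQ⟩ := exists_isometry_swap (x := x) (y := y) (by simp_all)
  exact (measure_ball_eq_of_map_eq Q.isometry (perpMeasure_map Q (hQ u hxu hyu)) x r).symm

lemma coneMeasure_ball (r : ℝ) :
    ∀ x ∈ sphere (0 : E n) 1, ∀ y ∈ sphere (0 : E n) 1,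
      coneMeasure n (ball x r) = coneMeasure n (ball y r) := by
  intro x hx y hy
  obtain ⟨Q, rfl, -⟩ := exists_isometry_swap (x := x) (y := y) (by simp_all)
  exact (measure_ball_eq_of_map_eq Q.isometry (coneMeasure_map Q) x r).symm

/-- The pairs of orthogonal unit vectors. -/
def flagSet (n : ℕ) : Set (E n × E n) :=
  {p | p.1 ∈ sphere (0 : E n) 1 ∧ p.2 ∈ sphere (0 : E n) 1 ∧ ⟪p.2, p.1⟫ = 0}

lemma isCompact_flagSet : IsCompact (flagSet n) := by
  have h : flagSet n = (sphere (0 : E n) 1 ×ˢ sphere (0 : E n) 1) ∩ {p | ⟪p.2, p.1⟫ = 0} := by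
    ext p
    simp [flagSet, and_assoc]
  rw [h]
  exact ((isCompact_sphere _ _).prod (isCompact_sphere _ _)).inter_right
    (isClosed_eq (by fun_prop) continuous_const)

lemma ae_flagMeasure (hn : 2 ≤ n) : ∀ᵐ p ∂flagMeasure n, p ∈ flagSet n := by
  have hm : MeasurableSet (flagSet n) := isCompact_flagSet.measurableSet
  refine ae_map_mem measurable_flag hm ?_
  refine (Measure.ae_prod_iff_ae_ae (measurable_flag hm)).2 ?_
  filter_upwards [ae_coneMeasure (by omega : 1 ≤ n)] with u hu
  filter_upwards [ae_ballMeasure_projPerp_ne_zero hn u] with x hx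
  exact ⟨hu, unitize_projPerp_mem hu hx⟩

lemma flagMeasure_ball (r : ℝ) :
    ∀ p ∈ flagSet n, ∀ q ∈ flagSet n,
      flagMeasure n (ball p r) = flagMeasure n (ball q r) := by
  have hinv : ∀ (Q : E n ≃ₗᵢ[ℝ] E n) (p : E n × E n),
      flagMeasure n (ball (Q p.1, Q p.2) r) = flagMeasure n (ball p r) := fun Q p =>
    measure_ball_eq_of_map_eq (Q.isometry.prodMap Q.isometry) (flagMeasure_map Q) p r
  rintro ⟨u, v⟩ ⟨hu, hv, huv⟩ ⟨u', v'⟩ ⟨hu', hv', huv'⟩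
  simp only at hu hv huv hu' hv' huv'
  obtain ⟨Q, rfl, -⟩ := exists_isometry_swap (x := u) (y := u') (by simp_all)
  obtain ⟨T, rfl, hT⟩ := exists_isometry_swap (x := Q v) (y := v') (by simp_all)
  have h := hT (Q u) (by simpa using huv) huv'
  rw [← hinv Q (u, v), ← hinv T (Q u, Q v)]
  simp only [h]

/-- The measure on pairs of orthogonal unit vectors is symmetric. -/
lemma flagMeasure_map_swap (hn : 2 ≤ n) : (flagMeasure n).map Prod.swap = flagMeasure n := by
  have huniv : (flagMeasure n).map Prod.swap univ = flagMeasure n univ := by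
    rw [Measure.map_apply measurable_swap .univ, preimage_univ]
  have hball : ∀ (p : E n × E n) (r : ℝ),
      (flagMeasure n).map Prod.swap (ball p r) = flagMeasure n (ball p.swap r) := by
    intro p r
    rw [Measure.map_apply measurable_swap measurableSet_ball]
    congr 1
    ext q
    simp [Prod.dist_eq, max_comm]
  have hswap : ∀ p ∈ flagSet n, p.swap ∈ flagSet n := fun p hp =>
    ⟨hp.2.1, hp.1, by rw [real_inner_comm]; exact hp.2.2⟩
  have h := smul_eq_smul_of_ball_eq (isCompact_flagSet (n := n))
    (μ := (flagMeasure n).map Prod.swap) (ν := flagMeasure n) ?_ (ae_flagMeasure hn) ?_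
    flagMeasure_ball
  · rw [huniv] at h
    have h0 : flagMeasure n univ ≠ 0 := by
      rw [flagMeasure_univ]
      exact mul_ne_zero ballMeasure_univ_ne_zero ballMeasure_univ_ne_zero
    ext s hs
    have hs' := congrArg (fun μ : Measure (E n × E n) => μ s) h
    simpa [ENNReal.mul_right_inj h0 (measure_ne_top _ _)] using hs'
  · refine ae_map_mem measurable_swap isCompact_flagSet.measurableSet ?_
    filter_upwards [ae_flagMeasure hn] with p hp using hswap p hp
  · intro r p hp q hq
    rw [hball, hball]
    exact flagMeasure_ball r _ (hswap p hp) _ (hswap q hq)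

/-- Self-adjointness of the spherical Radon transform. -/
lemma lintegral_mul_lintegral_perpMeasure (hn : 2 ≤ n) {f g : E n → ℝ≥0∞} (hf : Measurable f)
    (hg : Measurable g) :
    ∫⁻ u, f u * ∫⁻ v, g v ∂perpMeasure u ∂coneMeasure n
      = ∫⁻ v, g v * ∫⁻ u, f u ∂perpMeasure v ∂coneMeasure n := by
  have h1 := lintegral_flagMeasure (n := n) (F := fun p => f p.1 * g p.2) (by fun_prop)
  have h2 := lintegral_flagMeasure (n := n) (F := fun p => g p.1 * f p.2) (by fun_prop)
  simp only [lintegral_const_mul _ hf, lintegral_const_mul _ hg] at h1 h2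
  rw [← h1, ← h2]
  conv_lhs => rw [← flagMeasure_map_swap hn]
  rw [lintegral_map (by fun_prop) measurable_swap]
  simp [mul_comm]

end SphereMeasures

section PolarCoordinates

variable {n : ℕ}

lemma volumeIoiPow_Iic (k : ℕ) (x : Ioi (0 : ℝ)) :
    Measure.volumeIoiPow k (Iic x) = ENNReal.ofReal (x.1 ^ (k + 1) / (k + 1)) := by
  have hx : Measure.volumeIoiPow k {x} = 0 := by
    refine withDensity_absolutelyContinuous _ _ ?_
    rw [comap_subtype_coe_apply measurableSet_Ioi]
    simp
  rw [← Measure.volumeIoiPow_apply_Iio]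
  refine le_antisymm ?_ (measure_mono Iio_subset_Iic_self)
  rw [← Iio_union_right]
  exact (measure_union_le _ _).trans (by rw [hx, add_zero])

open scoped Pointwise in
lemma map_toSphere :
    (volume : Measure (E n)).toSphere.map Subtype.val = (n : ℝ≥0∞) • coneMeasure n := by
  ext s hs
  rw [Measure.map_apply measurable_subtype_coe hs,
    Measure.toSphere_apply' _ (measurable_subtype_coe hs), Measure.smul_apply, coneMeasure,
    Measure.map_apply measurable_unitize hs, ballMeasure,
    Measure.restrict_apply (measurable_unitize hs), finrank_euclideanSpace_fin, smul_eq_mul]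
  rcases Nat.eq_zero_or_pos n with rfl | hn
  · simp
  have : NeZero n := ⟨hn.ne'⟩
  congr 1
  have hset : Ioo (0 : ℝ) 1 • (Subtype.val '' (Subtype.val ⁻¹' s : Set (sphere (0 : E n) 1)))
      = (unitize ⁻¹' s ∩ ball 0 1) \ {0} := by
    ext x
    simp only [Set.mem_smul, mem_image, mem_preimage]
    constructor
    · rintro ⟨r, hr, -, ⟨⟨v, hv⟩, hvs, rfl⟩, rfl⟩
      have hv1 : ‖v‖ = 1 := by simpa using hv
      have hrpos : 0 < r := hr.1
      have hv0 : v ≠ 0 := by rintro rfl; simp at hv1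
      refine ⟨⟨?_, ?_⟩, ?_⟩
      · have : unitize (r • v) = v := by
          simp [unitize, norm_smul, hv1, abs_of_pos hrpos, smul_smul, hrpos.ne']
        simpa [this] using hvs
      · simpa [norm_smul, hv1, abs_of_pos hrpos] using hr.2
      · simp [hrpos.ne', hv0]
    · rintro ⟨⟨hxs, hxb⟩, hx0⟩
      have hx0' : x ≠ 0 := hx0
      refine ⟨‖x‖, ⟨norm_pos_iff.2 hx0', by simpa using hxb⟩, unitize x,
        ⟨⟨unitize x, unitize_mem_sphere hx0'⟩, hxs, rfl⟩, norm_smul_unitize hx0'⟩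
  rw [hset, measure_sdiff_null (measure_singleton _)]

/-- The volume of a star-shaped set in polar coordinates. -/
lemma volume_eq_lintegral_coneMeasure (hn : 1 ≤ n) {L : Set (E n)}
    {R : E n → ℝ} (hR : Measurable R)
    (h : ∀ v ∈ sphere (0 : E n) 1, ∀ t > 0, t • v ∈ L ↔ t ≤ R v) :
    volume L = ∫⁻ v, ENNReal.ofReal (R v) ^ n ∂coneMeasure n := by
  have : NeZero n := ⟨by omega⟩
  have hn0 : (n : ℝ≥0∞) ≠ 0 := by simpa using (by omega : n ≠ 0)
  let T : Set (sphere (0 : E n) 1 × Ioi (0 : ℝ)) := {p | p.2.1 ≤ R p.1.1}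
  have hT : MeasurableSet T := measurableSet_le (by fun_prop) (by fun_prop)
  have hpre : homeomorphUnitSphereProd (E n) ⁻¹' T = Subtype.val ⁻¹' L := by
    ext ⟨x, hx⟩
    have hx0 : x ≠ 0 := hx
    have hiff := h (unitize x) (unitize_mem_sphere hx0) ‖x‖ (norm_pos_iff.2 hx0)
    rw [norm_smul_unitize hx0] at hiff
    simp [T, hiff, unitize]
  have hmp := Measure.measurePreserving_homeomorphUnitSphereProd (volume : Measure (E n))
  have hvol : volume L = (Measure.comap (Subtype.val : ({0}ᶜ : Set (E n)) → E n) volume)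
      (Subtype.val ⁻¹' L) := by
    rw [comap_subtype_coe_apply (measurableSet_singleton _).compl, Subtype.image_preimage_coe,
      inter_comm, ← Set.sdiff_eq, measure_sdiff_null (measure_singleton _)]
  have hslice : ∀ v : sphere (0 : E n) 1,
      Measure.volumeIoiPow (Module.finrank ℝ (E n) - 1) (Prod.mk v ⁻¹' T)
        = (n : ℝ≥0∞)⁻¹ * ENNReal.ofReal (R v) ^ n := by
    intro v
    rw [finrank_euclideanSpace_fin]
    rcases le_or_gt (R v) 0 with hv | hv
    · have : Prod.mk v ⁻¹' T = (∅ : Set (Ioi (0 : ℝ))) := by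
        ext t
        simpa [T] using hv.trans_lt t.2
      rw [this, measure_empty, ENNReal.ofReal_of_nonpos hv, zero_pow (by omega), mul_zero]
    · have : Prod.mk v ⁻¹' T = Iic (⟨R v, hv⟩ : Ioi (0 : ℝ)) := by
        ext t
        simp [T, ← Subtype.coe_le_coe]
      rw [this, volumeIoiPow_Iic, Nat.sub_add_cancel hn, ENNReal.ofReal_div_of_pos (by positivity),
        ENNReal.ofReal_pow hv.le, ENNReal.div_eq_inv_mul]
      congr 2
      rw [← ENNReal.ofReal_natCast]
      congr 1
      exact_mod_cast Nat.sub_add_cancel hn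
  rw [hvol, ← hpre, hmp.measure_preimage hT.nullMeasurableSet, Measure.prod_apply hT]
  simp_rw [hslice]
  have hmeas : Measurable fun v : E n => ENNReal.ofReal (R v) ^ n := by fun_prop
  rw [lintegral_const_mul _ (by fun_prop),
    ← lintegral_map (f := fun v : E n => ENNReal.ofReal (R v) ^ n) hmeas measurable_subtype_coe,
    map_toSphere, lintegral_smul_measure, smul_eq_mul, ← mul_assoc,
    ENNReal.inv_mul_cancel hn0 (ENNReal.natCast_ne_top n), one_mul]

lemma IsStarBody.smul_mem_iff {L : Set (E n)} (hL : IsStarBody L) {v : E n}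
    (hv : v ∈ sphere (0 : E n) 1) {t : ℝ} (ht : 0 ≤ t) : t • v ∈ L ↔ t ≤ radialFn L v := by
  obtain ⟨hc, h0, hs, -⟩ := hL
  have hv1 : ‖v‖ = 1 := by simpa using hv
  have hclosed : IsClosed {c : ℝ | 0 ≤ c ∧ c • v ∈ L} :=
    isClosed_Ici.inter (hc.isClosed.preimage (by fun_prop : Continuous fun c : ℝ => c • v))
  have hne : {c : ℝ | 0 ≤ c ∧ c • v ∈ L}.Nonempty := ⟨0, le_rfl, by simpa using h0⟩
  have hbdd : BddAbove {c : ℝ | 0 ≤ c ∧ c • v ∈ L} := by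
    obtain ⟨M, hM⟩ := hc.isBounded.exists_norm_le
    refine ⟨M, fun c hc => ?_⟩
    have := hM _ hc.2
    rwa [norm_smul, hv1, mul_one, Real.norm_of_nonneg hc.1] at this
  refine ⟨fun h => le_csSup hbdd ⟨ht, h⟩, fun h => ?_⟩
  obtain ⟨hs0, hsL⟩ := hclosed.csSup_mem hne hbdd
  change 0 ≤ radialFn L v at hs0
  change radialFn L v • v ∈ L at hsL
  rcases hs0.eq_or_lt with hz | hpos
  · have : t = 0 := le_antisymm (h.trans hz.symm.le) ht
    simpa [this] using h0
  · have := starConvex_zero_iff.1 hs hsL (div_nonneg ht hpos.le)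
      ((div_le_one hpos).2 h)
    rwa [smul_smul, div_mul_cancel₀ _ hpos.ne'] at this

lemma exists_hausdorffMeasure_eq_smul_volume (n : ℕ) :
    ∃ c : ℝ≥0∞, c ≠ 0 ∧ c ≠ ∞ ∧ (μH[(n : ℝ)] : Measure (E n)) = c • volume := by
  have : (μH[(n : ℝ)] : Measure (E n)).IsAddHaarMeasure := by
    have := isAddHaarMeasure_hausdorffMeasure (E := E n)
    rwa [finrank_euclideanSpace_fin] at this
  exact ⟨_, by exact_mod_cast (Measure.addHaarScalarFactor_pos_of_isAddHaarMeasure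
    (μH[(n : ℝ)] : Measure (E n)) volume).ne', ENNReal.coe_ne_top,
    Measure.isAddLeftInvariant_eq_smul _ volume⟩

/-- A linear isometry of `ℝ^m` onto a hyperplane through the origin of `ℝ^(m+1)`. -/
lemma exists_isometry_range_eq_hyperplane {m : ℕ} {u : E (m + 1)}
    (hu : u ∈ sphere (0 : E (m + 1)) 1) :
    ∃ j : E m →ₗᵢ[ℝ] E (m + 1), range j = hyperplane u := by
  have hu0 : u ≠ 0 := by rintro rfl; simp at hu
  have : Fact (Module.finrank ℝ (E (m + 1)) = m + 1) := ⟨finrank_euclideanSpace_fin⟩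
  let e := (OrthonormalBasis.fromOrthogonalSpanSingleton (𝕜 := ℝ) m hu0).repr
  refine ⟨(ℝ ∙ u)ᗮ.subtypeₗᵢ.comp e.symm.toLinearIsometry, ?_⟩
  ext x
  rw [hyperplane, mem_ofPred_eq, ← Submodule.mem_orthogonal_singleton_iff_inner_left]
  constructor
  · rintro ⟨y, rfl⟩
    exact (e.symm y).2
  · intro hx
    exact ⟨e ⟨x, hx⟩, by simp⟩

lemma lintegral_coneMeasure_comp_isometry {m : ℕ} (hm : 1 ≤ m) {u : E (m + 1)}
    (hu : u ∈ sphere (0 : E (m + 1)) 1) (j : E m →ₗᵢ[ℝ] E (m + 1))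
    (hj : range j = hyperplane u) {f : E (m + 1) → ℝ≥0∞} (hf : Measurable f) :
    ∫⁻ v, f (j v) ∂coneMeasure m
      = ballMeasure m univ / ballMeasure (m + 1) univ * ∫⁻ v, f v ∂perpMeasure u := by
  have hjm : Measurable j := j.continuous.measurable
  have hX : ∀ x, x ∈ sphere (0 : E (m + 1)) 1 ∩ hyperplane u →
      ∃ v ∈ sphere (0 : E m) 1, j v = x := by
    rintro x ⟨hx, hxu⟩
    rw [← hj] at hxu
    obtain ⟨v, rfl⟩ := hxu
    exact ⟨v, by simpa using hx, rfl⟩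
  have hball : ∀ v r, (coneMeasure m).map j (ball (j v) r) = coneMeasure m (ball v r) := by
    intro v r
    rw [Measure.map_apply hjm measurableSet_ball, j.isometry.preimage_ball]
  have h := smul_eq_smul_of_ball_eq (isCompact_sphere_inter_hyperplane u)
    (μ := (coneMeasure m).map j) (ν := perpMeasure u) ?_ (ae_perpMeasure (by omega) hu) ?_
    perpMeasure_ball
  · have h' := congrArg (fun μ => ∫⁻ v, f v ∂μ) h
    simp only [lintegral_smul_measure, smul_eq_mul, perpMeasure_univ, lintegral_map hf hjm,
      Measure.map_apply hjm .univ, preimage_univ, coneMeasure_univ] at h'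
    rw [ENNReal.div_eq_inv_mul, mul_assoc, ← h', ← mul_assoc,
      ENNReal.inv_mul_cancel ballMeasure_univ_ne_zero (measure_ne_top _ _), one_mul]
  · refine ae_map_mem hjm (isCompact_sphere_inter_hyperplane u).measurableSet ?_
    filter_upwards [ae_coneMeasure hm] with v hv
    exact ⟨by simpa using hv, hj ▸ mem_range_self v⟩
  · intro r x hx y hy
    obtain ⟨v, hv, rfl⟩ := hX x hx
    obtain ⟨w, hw, rfl⟩ := hX y hy
    rw [hball, hball]
    exact coneMeasure_ball r v hv w hw

/-- The measures of the hyperplane sections of a star body are, up to a constant factor, the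
Radon transform of a power of the radial function. -/
lemma exists_hausdorffMeasure_section_eq {m : ℕ} (hm : 1 ≤ m) :
    ∃ K : ℝ≥0∞, K ≠ 0 ∧ K ≠ ∞ ∧ ∀ L : Set (E (m + 1)), IsStarBody L →
      ∀ R : E (m + 1) → ℝ, Measurable R → (∀ v ∈ sphere (0 : E (m + 1)) 1, R v = radialFn L v) →
      ∀ u ∈ sphere (0 : E (m + 1)) 1,
        μH[(m : ℝ)] (L ∩ hyperplane u)
          = K * ∫⁻ v, ENNReal.ofReal (R v) ^ m ∂perpMeasure u := by
  obtain ⟨c, hc0, hct, hc⟩ := exists_hausdorffMeasure_eq_smul_volume m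
  refine ⟨c * (ballMeasure m univ / ballMeasure (m + 1) univ),
    mul_ne_zero hc0 (ENNReal.div_ne_zero.2 ⟨ballMeasure_univ_ne_zero, measure_ne_top _ _⟩),
    ENNReal.mul_ne_top hct (ENNReal.div_ne_top (measure_ne_top _ _) ballMeasure_univ_ne_zero),
    fun L hL R hR hRL u hu => ?_⟩
  obtain ⟨j, hj⟩ := exists_isometry_range_eq_hyperplane hu
  have hjm : Measurable j := j.continuous.measurable
  rw [← hj, ← image_preimage_eq_inter_range,
    j.isometry.hausdorffMeasure_image (Or.inl (Nat.cast_nonneg m)), hc, Measure.smul_apply,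
    smul_eq_mul, volume_eq_lintegral_coneMeasure hm (R := fun v => R (j v)) (by fun_prop),
    lintegral_coneMeasure_comp_isometry hm hu j hj
      (f := fun v => ENNReal.ofReal (R v) ^ m) (by fun_prop), mul_assoc]
  intro v hv t ht
  have hjv : j v ∈ sphere (0 : E (m + 1)) 1 := by simpa using hv
  rw [mem_preimage, map_smul, hL.smul_mem_iff hjv ht.le, hRL _ hjv]

end PolarCoordinates

section RadonTransform

variable {n : ℕ}

/-- Surface measure on the great subsphere orthogonal to `u`. -/
def greatSphereMeasure (u : E n) : Measure (E n) :=
  (μH[(n : ℝ) - 2]).restrict (sphere (0 : E n) 1 ∩ hyperplane u)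

lemma image_sphere_inter_hyperplane (Q : E n ≃ₗᵢ[ℝ] E n) (u : E n) :
    Q '' (sphere (0 : E n) 1 ∩ hyperplane u) = sphere (0 : E n) 1 ∩ hyperplane (Q u) := by
  ext x
  constructor
  · rintro ⟨y, ⟨hy, hyu⟩, rfl⟩
    exact ⟨by simpa using hy, by simpa [hyperplane] using hyu⟩
  · rintro ⟨hx, hxu⟩
    obtain ⟨y, rfl⟩ := Q.surjective x
    exact ⟨y, ⟨by simpa using hx, by simpa [hyperplane] using hxu⟩, rfl⟩

lemma greatSphereMeasure_univ (u : E n) :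
    greatSphereMeasure u univ = μH[(n : ℝ) - 2] (sphere (0 : E n) 1 ∩ hyperplane u) := by
  rw [greatSphereMeasure, Measure.restrict_apply_univ]

lemma greatSphereMeasure_univ_eq {u v : E n} (h : ‖u‖ = ‖v‖) :
    greatSphereMeasure u univ = greatSphereMeasure v univ := by
  obtain ⟨Q, rfl, -⟩ := exists_isometry_swap h
  rw [greatSphereMeasure_univ, greatSphereMeasure_univ, ← image_sphere_inter_hyperplane]
  exact (Q.toIsometryEquiv.hausdorffMeasure_image _ _).symm

lemma greatSphereMeasure_ball {u : E n} (r : ℝ) :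
    ∀ x ∈ sphere (0 : E n) 1 ∩ hyperplane u, ∀ y ∈ sphere (0 : E n) 1 ∩ hyperplane u,
      greatSphereMeasure u (ball x r) = greatSphereMeasure u (ball y r) := by
  rintro x ⟨hx, hxu⟩ y ⟨hy, hyu⟩
  obtain ⟨Q, rfl, hQ⟩ := exists_isometry_swap (x := x) (y := y) (by simp_all)
  have hu : Q u = u := hQ u hxu hyu
  rw [greatSphereMeasure, Measure.restrict_apply measurableSet_ball,
    Measure.restrict_apply measurableSet_ball]
  have h := image_sphere_inter_hyperplane Q u
  rw [hu] at h
  conv_rhs => rw [← h, ← Q.image_ball, ← image_inter Q.injective]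
  exact (Q.toIsometryEquiv.hausdorffMeasure_image _ _).symm

lemma ae_greatSphereMeasure (u : E n) :
    ∀ᵐ x ∂greatSphereMeasure u, x ∈ sphere (0 : E n) 1 ∩ hyperplane u :=
  ae_restrict_mem (isCompact_sphere_inter_hyperplane u).measurableSet

/-- A nonnegative continuous function has vanishing Bochner integral over a great subsphere
of infinite measure. -/
lemma integral_greatSphereMeasure_eq_zero {u : E n} (hinf : greatSphereMeasure u univ = ∞)
    {G : E n → ℝ} (hG : Continuous G) (hG0 : ∀ v, 0 ≤ G v) :
    ∫ v, G v ∂greatSphereMeasure u = 0 := by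
  rw [integral_eq_lintegral_of_nonneg_ae (.of_forall hG0) hG.aestronglyMeasurable,
    ENNReal.toReal_eq_zero_iff]
  by_cases h : ∃ v ∈ sphere (0 : E n) 1 ∩ hyperplane u, 0 < G v
  · right
    obtain ⟨v, hv, hGv⟩ := h
    obtain ⟨r, hr, hball⟩ := Metric.isOpen_iff.1 (isOpen_lt continuous_const hG) v
      (show G v / 2 < G v by linarith)
    have hmeas : greatSphereMeasure u (ball v r) = ∞ := by
      by_contra hfin
      obtain ⟨t, htX, htf, hcov⟩ :=
        (isCompact_sphere_inter_hyperplane u).finite_cover_balls hr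
      have h1 : greatSphereMeasure u (⋃ x ∈ t, ball x r) < ∞ :=
        measure_biUnion_lt_top htf fun x hx => by
          rw [greatSphereMeasure_ball r x (htX hx) v hv]
          exact lt_top_iff_ne_top.2 hfin
      have h2 : greatSphereMeasure u univ ≤ greatSphereMeasure u (⋃ x ∈ t, ball x r) := by
        refine measure_mono_ae ?_
        filter_upwards [ae_greatSphereMeasure u] with x hx _ using hcov hx
      exact absurd (hinf ▸ h2) (not_le.2 h1)
    rw [eq_top_iff]
    calc ∞ = ENNReal.ofReal (G v / 2) * greatSphereMeasure u (ball v r) := by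
          rw [hmeas, ENNReal.mul_top (by simpa using hGv)]
      _ = ∫⁻ _ in ball v r, ENNReal.ofReal (G v / 2) ∂greatSphereMeasure u := by
          rw [setLIntegral_const]
      _ ≤ ∫⁻ x in ball v r, ENNReal.ofReal (G x) ∂greatSphereMeasure u :=
          setLIntegral_mono' measurableSet_ball fun x hx =>
            ENNReal.ofReal_le_ofReal (hball hx).le
      _ ≤ ∫⁻ x, ENNReal.ofReal (G x) ∂greatSphereMeasure u := setLIntegral_le_lintegral _ _
  · left
    push Not at h
    rw [lintegral_eq_zero_iff (by fun_prop)]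
    filter_upwards [ae_greatSphereMeasure u] with x hx
    simpa using h x hx

lemma exists_ofReal_integral_greatSphereMeasure_eq (hn : 2 ≤ n) :
    ∃ k : ℝ≥0∞, ∀ G : E n → ℝ, Continuous G → (∀ v, 0 ≤ G v) → ∀ u ∈ sphere (0 : E n) 1,
      ENNReal.ofReal (∫ v, G v ∂greatSphereMeasure u)
        = k * ∫⁻ v, ENNReal.ofReal (G v) ∂perpMeasure u := by
  by_cases hne : ∃ u₀, u₀ ∈ sphere (0 : E n) 1
  swap
  · push Not at hne
    exact ⟨0, fun _ _ _ u hu => absurd hu (hne u)⟩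
  obtain ⟨u₀, hu₀⟩ := hne
  by_cases hinf : greatSphereMeasure u₀ univ = ∞
  · refine ⟨0, fun G hG hG0 u hu => ?_⟩
    rw [integral_greatSphereMeasure_eq_zero _ hG hG0, ENNReal.ofReal_zero, zero_mul]
    rw [greatSphereMeasure_univ_eq (v := u₀) (by simp_all), hinf]
  refine ⟨greatSphereMeasure u₀ univ / ballMeasure n univ, fun G hG hG0 u hu => ?_⟩
  have huniv : greatSphereMeasure u univ = greatSphereMeasure u₀ univ :=
    greatSphereMeasure_univ_eq (by simp_all)
  have : IsFiniteMeasure (greatSphereMeasure u) := ⟨by rw [huniv]; exact lt_top_iff_ne_top.2 hinf⟩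
  have h := smul_eq_smul_of_ball_eq (isCompact_sphere_inter_hyperplane u)
    (ae_greatSphereMeasure u) (ae_perpMeasure hn hu) greatSphereMeasure_ball perpMeasure_ball
  have h' := congrArg (fun μ => ∫⁻ v, ENNReal.ofReal (G v) ∂μ) h
  simp only [lintegral_smul_measure, smul_eq_mul, perpMeasure_univ, huniv] at h'
  obtain ⟨C, hC⟩ := (isCompact_sphere_inter_hyperplane u).exists_bound_of_continuousOn
    hG.continuousOn
  have hint : Integrable G (greatSphereMeasure u) :=
    .of_bound hG.aestronglyMeasurable C <| by
      filter_upwards [ae_greatSphereMeasure u] with x hx using hC x hx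
  rw [ofReal_integral_eq_lintegral_ofReal hint (.of_forall hG0), ENNReal.div_eq_inv_mul,
    mul_assoc, ← h', ← mul_assoc,
    ENNReal.inv_mul_cancel ballMeasure_univ_ne_zero (measure_ne_top _ _), one_mul]

end RadonTransform

lemma exists_continuous_nonneg_extension {n : ℕ} {f : E n → ℝ}
    (hf : ContinuousOn f (sphere 0 1)) (hf0 : ∀ v ∈ sphere (0 : E n) 1, 0 ≤ f v) :
    ∃ F : E n → ℝ, Continuous F ∧ (∀ v, 0 ≤ F v) ∧ ∀ v ∈ sphere (0 : E n) 1, F v = f v := by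
  obtain ⟨F, hF0, hF⟩ := ContinuousMap.exists_restrict_eq_forall_mem_of_closed
    (⟨_, hf.domRestrict⟩ : C(sphere (0 : E n) 1, ℝ)) (t := Ici 0) (fun x => hf0 x x.2)
    nonempty_Ici isClosed_sphere
  exact ⟨F, F.continuous, hF0, fun v hv => DFunLike.congr_fun hF ⟨v, hv⟩⟩

lemma succ_mul_pow_mul_le {a b : ℝ} (ha : 0 ≤ a) (hb : 0 ≤ b) (m : ℕ) :
    (m + 1) * (b ^ m * a) ≤ m * b ^ (m + 1) + a ^ (m + 1) := by
  induction m with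
  | zero => simp
  | succ m ih =>
    have h1 := mul_le_mul_of_nonneg_left ih ha
    have h2 : 0 ≤ (m + 1) * b ^ m * (a - b) ^ 2 := by positivity
    push_cast
    have e : (m + 1 + 1) * (b ^ (m + 1) * a) + (m + 1) * b ^ m * (a - b) ^ 2
          + a * (m * b ^ (m + 1) + a ^ (m + 1))
        = (m + 1) * b ^ (m + 1 + 1) + a ^ (m + 1 + 1) + a * ((m + 1) * (b ^ m * a)) := by
      ring
    linarith

lemma ennreal_succ_mul_pow_mul_le {a b : ℝ} (ha : 0 ≤ a) (hb : 0 ≤ b) (m : ℕ) :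
    ((m : ℝ≥0∞) + 1) * (ENNReal.ofReal b ^ m * ENNReal.ofReal a)
      ≤ m * ENNReal.ofReal b ^ (m + 1) + ENNReal.ofReal a ^ (m + 1) := by
  have h := ENNReal.ofReal_le_ofReal (succ_mul_pow_mul_le ha hb m)
  rw [ENNReal.ofReal_add (by positivity) (by positivity), ENNReal.ofReal_mul (by positivity),
    ENNReal.ofReal_mul (by positivity), ENNReal.ofReal_mul (by positivity),
    ENNReal.ofReal_add (by positivity) (by positivity), ENNReal.ofReal_pow hb,
    ENNReal.ofReal_pow hb, ENNReal.ofReal_pow ha, ENNReal.ofReal_natCast,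
    ENNReal.ofReal_one] at h
  exact h

/-- Lutwak's theorem: if `L₁` is the intersection body of some star body
(`ρ_{L₁} = Rg` with `g ≥ 0` continuous) and `L₂` is an arbitrary star body with
`λ_{n-1}(L₁ ∩ u^⊥) ≤ λ_{n-1}(L₂ ∩ u^⊥)` for all directions `u`, then
`λ_n(L₁) ≤ λ_n(L₂)`. -/
theorem lutwak (n : ℕ) (hn : 2 ≤ n) (L₁ L₂ : Set (E n))
    (hL₁ : IsStarBody L₁) (hL₂ : IsStarBody L₂)
    (g : E n → ℝ) (hg : ContinuousOn g (sphere (0 : E n) 1))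
    (hg0 : ∀ v ∈ sphere (0 : E n) 1, 0 ≤ g v)
    (hrad : ∀ u ∈ sphere (0 : E n) 1, radialFn L₁ u = radon n g u)
    (hsec : ∀ u ∈ sphere (0 : E n) 1,
      μH[(n : ℝ) - 1] (L₁ ∩ hyperplane u) ≤ μH[(n : ℝ) - 1] (L₂ ∩ hyperplane u)) :
    μH[(n : ℝ)] L₁ ≤ μH[(n : ℝ)] L₂ := by
  obtain ⟨m, rfl⟩ : ∃ m, n = m + 1 := ⟨n - 1, by omega⟩
  have hm : 1 ≤ m := by omega
  have hpos : ∀ {L : Set (E (m + 1))}, IsStarBody L → ∀ v ∈ sphere (0 : E (m + 1)) 1,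
      0 ≤ radialFn L v := fun hL v hv =>
    (hL.smul_mem_iff hv le_rfl).1 (by simpa using hL.2.1)
  obtain ⟨R₁, hR₁c, hR₁0, hR₁⟩ := exists_continuous_nonneg_extension hL₁.2.2.2 (hpos hL₁)
  obtain ⟨R₂, hR₂c, hR₂0, hR₂⟩ := exists_continuous_nonneg_extension hL₂.2.2.2 (hpos hL₂)
  obtain ⟨G, hGc, hG0, hG⟩ := exists_continuous_nonneg_extension hg hg0
  obtain ⟨c, -, -, hc⟩ := exists_hausdorffMeasure_eq_smul_volume (m + 1)
  obtain ⟨K, hK0, hKt, hK⟩ := exists_hausdorffMeasure_section_eq hm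
  obtain ⟨k, hk⟩ := exists_ofReal_integral_greatSphereMeasure_eq hn
  have hvol : ∀ {L : Set (E (m + 1))}, IsStarBody L → ∀ R : E (m + 1) → ℝ, Continuous R →
      (∀ v ∈ sphere (0 : E (m + 1)) 1, R v = radialFn L v) →
      volume L = ∫⁻ v, ENNReal.ofReal (R v) ^ (m + 1) ∂coneMeasure (m + 1) :=
    fun hL R hRc hR => volume_eq_lintegral_coneMeasure (by omega) hRc.measurable
      fun v hv t ht => by rw [hL.smul_mem_iff hv ht.le, hR v hv]
  have hradon : ∀ᵐ u ∂coneMeasure (m + 1),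
      ENNReal.ofReal (R₁ u) = k * ∫⁻ v, ENNReal.ofReal (G v) ∂perpMeasure u := by
    filter_upwards [ae_coneMeasure (by omega : 1 ≤ m + 1)] with u hu
    rw [← hk G hGc hG0 u hu, hR₁ u hu, hrad u hu]
    congr 1
    exact integral_congr_ae <| by
      filter_upwards [ae_greatSphereMeasure u] with v hv using (hG v hv.1).symm
  have hsections : ∀ᵐ u ∂coneMeasure (m + 1),
      ∫⁻ v, ENNReal.ofReal (R₁ v) ^ m ∂perpMeasure u
        ≤ ∫⁻ v, ENNReal.ofReal (R₂ v) ^ m ∂perpMeasure u := by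
    filter_upwards [ae_coneMeasure (by omega : 1 ≤ m + 1)] with u hu
    have h := hsec u hu
    rw [Nat.cast_add_one, add_sub_cancel_right, hK L₁ hL₁ R₁ hR₁c.measurable hR₁ u hu,
      hK L₂ hL₂ R₂ hR₂c.measurable hR₂ u hu] at h
    exact (ENNReal.mul_le_mul_iff_right hK0 hKt).1 h
  have hmixed : ∀ R : E (m + 1) → ℝ, Continuous R →
      ∫⁻ u, ENNReal.ofReal (R u) ^ m * ENNReal.ofReal (R₁ u) ∂coneMeasure (m + 1)
        = k * ∫⁻ v, ENNReal.ofReal (G v) * ∫⁻ u, ENNReal.ofReal (R u) ^ m ∂perpMeasure v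
            ∂coneMeasure (m + 1) := by
    intro R hR
    have hGm : Measurable fun v => k * ENNReal.ofReal (G v) := by fun_prop
    have hRm : Measurable fun u => ENNReal.ofReal (R u) ^ m := by fun_prop
    have h1 : ∫⁻ u, ENNReal.ofReal (R u) ^ m * ENNReal.ofReal (R₁ u) ∂coneMeasure (m + 1)
        = ∫⁻ u, ENNReal.ofReal (R u) ^ m * ∫⁻ v, k * ENNReal.ofReal (G v) ∂perpMeasure u
            ∂coneMeasure (m + 1) := by
      refine lintegral_congr_ae ?_
      filter_upwards [hradon] with u hu
      rw [hu, lintegral_const_mul _ (by fun_prop)]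
    rw [h1, lintegral_mul_lintegral_perpMeasure hn hRm hGm]
    rw [← lintegral_const_mul _ (by
      have := measurable_lintegral_perpMeasure hRm
      fun_prop)]
    simp only [mul_assoc]
  have hmain : volume L₁ ≤ volume L₂ := by
    have hfin : volume L₁ ≠ ∞ := hL₁.1.measure_ne_top
    have h1 : volume L₁ ≤ ∫⁻ u, ENNReal.ofReal (R₂ u) ^ m * ENNReal.ofReal (R₁ u)
        ∂coneMeasure (m + 1) := by
      rw [hvol hL₁ R₁ hR₁c hR₁]
      simp only [pow_succ]
      rw [hmixed R₁ hR₁c, hmixed R₂ hR₂c]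
      refine mul_le_mul' le_rfl (lintegral_mono_ae ?_)
      filter_upwards [hsections] with u hu using mul_le_mul' le_rfl hu
    have h2 : ((m : ℝ≥0∞) + 1) * volume L₁ ≤ m * volume L₂ + volume L₁ := by
      refine (mul_le_mul' le_rfl h1).trans ?_
      rw [hvol hL₁ R₁ hR₁c hR₁, hvol hL₂ R₂ hR₂c hR₂, ← lintegral_const_mul _ (by fun_prop),
        ← lintegral_const_mul _ (by fun_prop), ← lintegral_add_left (by fun_prop)]
      exact lintegral_mono fun u => ennreal_succ_mul_pow_mul_le (hR₁0 u) (hR₂0 u) m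
    rw [add_mul, one_mul] at h2
    have h3 := ENNReal.le_of_add_le_add_right hfin h2
    exact (ENNReal.mul_le_mul_iff_right (by simpa using (by omega : m ≠ 0))
      (ENNReal.natCast_ne_top m)).1 h3
  rw [hc]
  exact mul_le_mul' le_rfl hmain
end
end

section
/- Let n = 3 or n = 4, let K₁ be a centered convex body of revolution in ℝⁿ (about some axis u₀ ∈ S^{n−1}), and let K₂ be a centered convex body in ℝⁿ with λ_{n−1}(K₁ ∩ u^⊥) ≤ λ_{n−1}(K₂ ∩ u^⊥) for all u ∈ S^{n−1}. Then λ_n(K₁) ≤ λ_n(K₂). -/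
open MeasureTheory Metric
open scoped RealInnerProductSpace ENNReal

noncomputable section

/-- Polar coordinates in the plane for a radial function. -/
theorem lintegral_norm_complex {g : ℝ → ℝ≥0∞} (hg : Measurable g) :
    ∫⁻ z : ℂ, g ‖z‖ = ENNReal.ofReal (2 * Real.pi) * ∫⁻ ρ in Set.Ioi 0, ENNReal.ofReal ρ * g ρ := by
  have h : ∀ p ∈ polarCoord.target,
      ENNReal.ofReal p.1 • g ‖Complex.polarCoord.symm p‖ = ENNReal.ofReal p.1 * g p.1 := by
    rintro ⟨ρ, θ⟩ hp
    rw [polarCoord_target] at hp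
    have hρ : 0 < ρ := hp.1
    rw [Complex.norm_polarCoord_symm, abs_of_pos hρ, smul_eq_mul]
  rw [← Complex.lintegral_comp_polarCoord_symm,
    setLIntegral_congr_fun polarCoord.open_target.measurableSet h, polarCoord_target,
    Measure.volume_eq_prod, ← Measure.prod_restrict, lintegral_prod _ (by fun_prop)]
  simp only [lintegral_const, Measure.restrict_apply MeasurableSet.univ, Set.univ_inter,
    Real.volume_Ioo]
  rw [lintegral_mul_const _ (by fun_prop), mul_comm]
  ring_nf

theorem image_sqrt_sq_add (s : ℝ) :
    (fun ρ : ℝ => √(s ^ 2 + ρ ^ 2)) '' Set.Ioi 0 = Set.Ioi |s| := by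
  ext t
  constructor
  · rintro ⟨ρ, hρ, rfl⟩
    have : 0 < ρ := hρ
    exact Real.lt_sqrt_of_sq_lt (by rw [sq_abs]; nlinarith)
  · intro ht
    have h1 : |s| < t := ht
    have h0 : 0 < t := (abs_nonneg s).trans_lt h1
    have h2 : s ^ 2 < t ^ 2 := sq_lt_sq.2 (by rwa [abs_of_pos h0])
    refine ⟨√(t ^ 2 - s ^ 2), Real.sqrt_pos.2 (by linarith), ?_⟩
    dsimp only
    rw [Real.sq_sqrt (by linarith), add_sub_cancel, Real.sqrt_sq h0.le]

/-- The integral of a radial function of `ℝ³` over the plane at distance `|s|` from the origin. -/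
theorem lintegral_plane_section {w : ℝ → ℝ≥0∞} (hw : Measurable w) (s : ℝ) :
    ∫⁻ z : ℂ, w √(s ^ 2 + ‖z‖ ^ 2)
      = ENNReal.ofReal (2 * Real.pi) * ∫⁻ t in Set.Ioi |s|, ENNReal.ofReal t * w t := by
  rw [lintegral_norm_complex (g := fun ρ => w √(s ^ 2 + ρ ^ 2)) (by fun_prop),
    ← image_sqrt_sq_add s,
    lintegral_image_eq_lintegral_abs_deriv_mul (f' := fun ρ => ρ / √(s ^ 2 + ρ ^ 2))
      measurableSet_Ioi]
  · congr 1
    refine setLIntegral_congr_fun measurableSet_Ioi fun ρ hρ => ?_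
    have h0 : 0 < ρ := hρ
    have h1 : 0 < √(s ^ 2 + ρ ^ 2) := Real.sqrt_pos.2 (by positivity)
    rw [← mul_assoc, ← ENNReal.ofReal_mul (abs_nonneg _), abs_of_pos (by positivity),
      div_mul_cancel₀ _ h1.ne']
  · intro ρ hρ
    have h0 : 0 < ρ := hρ
    have h1 : HasDerivAt (fun ρ : ℝ => s ^ 2 + ρ ^ 2) (2 * ρ) ρ := by
      simpa using (hasDerivAt_pow 2 ρ).const_add (s ^ 2)
    exact ((h1.sqrt (by positivity)).congr_deriv
      (mul_div_mul_left _ _ two_ne_zero)).hasDerivWithinAt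
  · intro a ha b hb hab
    have ha : 0 < a := ha
    have hb : 0 < b := hb
    have := (Real.sqrt_inj (by positivity) (by positivity)).1 hab
    exact (sq_eq_sq₀ ha.le hb.le).1 (by linarith)

/-- Euclidean three-space, as `ℝ × ℂ` with the Euclidean norm. -/
abbrev Space := WithLp 2 (ℝ × ℂ)

theorem lintegral_radial_mul_fst {w φ : ℝ → ℝ≥0∞} (hw : Measurable w) (hφ : Measurable φ) :
    ∫⁻ p : Space, w ‖p‖ * φ p.fst = ENNReal.ofReal (2 * Real.pi) *
      ∫⁻ s, φ s * ∫⁻ t in Set.Ioi |s|, ENNReal.ofReal t * w t := by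
  have h : ∀ p : Space, w ‖p‖ * φ p.fst
      = (fun q : ℝ × ℂ => w √(q.1 ^ 2 + ‖q.2‖ ^ 2) * φ q.1) (WithLp.ofLp p) := by
    intro p
    rw [WithLp.prod_norm_eq_of_L2]
    simp
  rw [lintegral_congr h, (WithLp.volume_preserving_ofLp ℝ ℂ).lintegral_comp
    (f := fun q : ℝ × ℂ => w √(q.1 ^ 2 + ‖q.2‖ ^ 2) * φ q.1) (by fun_prop), Measure.volume_eq_prod,
    lintegral_prod _ (by fun_prop)]
  have h2 : ∀ s : ℝ, ∫⁻ z : ℂ, w √(s ^ 2 + ‖z‖ ^ 2) * φ s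
      = ENNReal.ofReal (2 * Real.pi) * (φ s * ∫⁻ t in Set.Ioi |s|, ENNReal.ofReal t * w t) := by
    intro s
    rw [lintegral_mul_const _ (by fun_prop), lintegral_plane_section hw]
    ring
  simp only [h2]
  rw [lintegral_const_mul' _ _ ENNReal.ofReal_ne_top]

/-- A one-dimensional marginal of a radial measure on three-space. -/
theorem lintegral_radial_mul_inner {w φ : ℝ → ℝ≥0∞} (hw : Measurable w) (hφ : Measurable φ)
    {e : Space} (he : ‖e‖ = 1) :
    ∫⁻ p : Space, w ‖p‖ * φ ⟪e, p⟫ = ENNReal.ofReal (2 * Real.pi) *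
      ∫⁻ s, φ s * ∫⁻ t in Set.Ioi |s|, ENNReal.ofReal t * w t := by
  set e₀ : Space := WithLp.toLp 2 (1, 0) with he₀
  have hn : ‖e‖ = ‖e₀‖ := by
    rw [he, he₀, WithLp.prod_norm_eq_of_L2]
    simp
  set R := (ℝ ∙ (e - e₀))ᗮ.reflection
  have hR : R e = e₀ := Submodule.reflection_sub hn
  have h : ∀ p : Space, w ‖p‖ * φ ⟪e, p⟫ = (fun q : Space => w ‖q‖ * φ q.fst) (R p) := by
    intro p
    have : ⟪e, p⟫ = (R p).fst := by
      rw [← R.inner_map_map, hR, he₀, WithLp.prod_inner_apply]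
      simp
    simp [this]
  have hm : Measurable fun q : Space => w ‖q‖ * φ q.fst := by
    have : Measurable fun q : Space => q.fst := (WithLp.continuous_fst 2 ℝ ℂ).measurable
    fun_prop
  rw [lintegral_congr h, R.measurePreserving.lintegral_comp hm, lintegral_radial_mul_fst hw hφ]

theorem lintegral_Ioi_neg_deriv {r : ℝ → ℝ} {C : NNReal} (hL : LipschitzWith C r)
    (ha : AntitoneOn r (Set.Ici 0)) (h0 : Filter.Tendsto r Filter.atTop (nhds 0)) {s : ℝ}
    (hs : 0 ≤ s) : ∫⁻ t in Set.Ioi s, ENNReal.ofReal (-deriv r t) = ENNReal.ofReal (r s) := by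
  have hm : Measurable fun t => ENNReal.ofReal (-deriv r t) := by
    have := measurable_deriv r
    fun_prop
  have hneg : ∀ t, 0 < t → deriv r t ≤ 0 := by
    intro t ht
    rw [← derivWithin_of_isOpen isOpen_Ioi (Set.mem_Ioi.2 ht)]
    exact (ha.mono Set.Ioi_subset_Ici_self).derivWithin_nonpos
  refine (aecover_Iic (Filter.tendsto_id (α := ℝ) (x := Filter.atTop))).lintegral_eq_of_tendsto _
    hm.aemeasurable ?_
  have h1 : Filter.Tendsto (fun b => ENNReal.ofReal (r s - r b)) Filter.atTop
      (nhds (ENNReal.ofReal (r s))) := by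
    simpa using ENNReal.tendsto_ofReal (h0.const_sub (r s))
  refine h1.congr' ?_
  filter_upwards [Filter.eventually_ge_atTop s] with b hb
  have hac : AbsolutelyContinuousOnInterval r s b :=
    (hL.lipschitzOnWith (s := Set.uIcc s b)).absolutelyContinuousOnInterval
  have hintr := hac.intervalIntegrable_deriv
  rw [Measure.restrict_restrict measurableSet_Iic, Set.inter_comm, id, Set.Ioi_inter_Iic,
    ← ofReal_integral_eq_lintegral_ofReal (f := fun t => -deriv r t) hintr.1.neg, integral_neg,
    ← intervalIntegral.integral_of_le hb, hac.integral_deriv_eq_sub, neg_sub]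
  filter_upwards [ae_restrict_mem measurableSet_Ioc] with t ht
  exact neg_nonneg.2 (hneg t (hs.trans_lt ht.1))

theorem ConvexOn.le_of_abs_le_of_even {f : ℝ → ℝ} (hc : ConvexOn ℝ Set.univ f)
    (he : ∀ t, f (-t) = f t) {a b : ℝ} (hab : |a| ≤ b) : f a ≤ f b := by
  have := hc.le_max_of_mem_Icc (Set.mem_univ (-b)) (Set.mem_univ b) (abs_le.1 hab)
  simpa [he] using this

/-- The reciprocal of an even convex function growing to infinity is an integral of the radial
sections of a nonnegative density. -/
theorem exists_radial_weight {f : ℝ → ℝ} {C : NNReal} (hL : LipschitzWith C f)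
    (hc : ConvexOn ℝ Set.univ f) (he : ∀ t, f (-t) = f t) (h0 : 0 < f 0)
    (hlim : Filter.Tendsto f Filter.atTop Filter.atTop) :
    ∃ w : ℝ → ℝ≥0∞, Measurable w ∧
      ∀ s, ∫⁻ t in Set.Ioi |s|, ENNReal.ofReal t * w t = ENNReal.ofReal (f |s|)⁻¹ := by
  have hle : ∀ t, f 0 ≤ f t := fun t => by
    have h := hc.le_of_abs_le_of_even he (a := 0) (b := |t|) (by simp)
    rcases abs_choice t with h' | h' <;> simpa [h', he] using h
  have hpos : ∀ t, 0 < f t := fun t => h0.trans_le (hle t)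
  have hLr : LipschitzWith (C / ⟨f 0, h0.le⟩ ^ 2) fun t => (f t)⁻¹ := by
    refine LipschitzWith.of_dist_le_mul fun a b => ?_
    have h1 := hL.dist_le_mul a b
    rw [Real.dist_eq] at h1 ⊢
    rw [inv_sub_inv (hpos a).ne' (hpos b).ne', abs_div, abs_of_pos (mul_pos (hpos a) (hpos b)),
      abs_sub_comm, NNReal.coe_div, div_mul_eq_mul_div]
    refine div_le_div₀ (by positivity) h1 (pow_pos h0 2) ?_
    change f 0 ^ 2 ≤ _
    nlinarith [hle a, hle b]
  have hanti : AntitoneOn (fun t => (f t)⁻¹) (Set.Ici 0) := by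
    intro a ha b _ hab
    have ha : 0 ≤ a := ha
    exact inv_anti₀ (hpos a) (hc.le_of_abs_le_of_even he (by rwa [abs_of_nonneg ha]))
  refine ⟨fun t => ENNReal.ofReal (-deriv (fun t => (f t)⁻¹) t / t), ?_, fun s => ?_⟩
  · have := measurable_deriv fun t => (f t)⁻¹
    fun_prop
  · rw [← lintegral_Ioi_neg_deriv hLr hanti hlim.inv_tendsto_atTop (abs_nonneg s)]
    refine setLIntegral_congr_fun measurableSet_Ioi fun t ht => ?_
    have ht : 0 < t := (abs_nonneg s).trans_lt ht
    rw [← ENNReal.ofReal_mul ht.le, mul_div_cancel₀ _ ht.ne']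

/-- Comparison with respect to a density that is at least one on `A` and at most one off `A`. -/
theorem measure_le_of_setLIntegral_le {α : Type*} [MeasurableSpace α] {μ : Measure α} {A B : Set α}
    (hA : MeasurableSet A) (hB : MeasurableSet B) {d : α → ℝ≥0∞} (h1 : ∀ x ∈ A, 1 ≤ d x)
    (h2 : ∀ x ∉ A, d x ≤ 1) (hfin : ∫⁻ x in A, d x ∂μ ≠ ∞)
    (h : ∫⁻ x in A, d x ∂μ ≤ ∫⁻ x in B, d x ∂μ) : μ A ≤ μ B := by
  rw [← lintegral_inter_add_sdiff d A hB, ← lintegral_inter_add_sdiff d B hA, Set.inter_comm B A] at h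
  have hf : ∫⁻ x in A ∩ B, d x ∂μ ≠ ∞ :=
    ((lintegral_mono_set Set.inter_subset_left).trans_lt hfin.lt_top).ne
  have h3 := (ENNReal.add_le_add_iff_left hf).1 h
  have h4 : μ (A \ B) ≤ μ (B \ A) := by
    calc μ (A \ B) = ∫⁻ _ in A \ B, 1 ∂μ := by simp
      _ ≤ ∫⁻ x in A \ B, d x ∂μ := setLIntegral_mono' (hA.diff hB) fun x hx => h1 x hx.1
      _ ≤ ∫⁻ x in B \ A, d x ∂μ := h3
      _ ≤ ∫⁻ _ in B \ A, 1 ∂μ := setLIntegral_mono' (hB.diff hA) fun x hx => h2 x hx.2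
      _ = μ (B \ A) := by simp
  rw [← measure_inter_add_sdiff A hB, ← measure_inter_add_sdiff B hA, Set.inter_comm B A]
  gcongr

theorem lintegral_comp_mul_left_of_pos {h : ℝ → ℝ≥0∞} (hh : Measurable h) {a : ℝ} (ha : 0 < a) :
    ∫⁻ s, h (a * s) = ∫⁻ t, ENNReal.ofReal a⁻¹ * h t := by
  rw [← lintegral_map (f := h) hh (measurable_const_mul a), Real.map_volume_mul_left ha.ne',
    lintegral_smul_measure, lintegral_const_mul _ hh, abs_of_pos (inv_pos.2 ha), smul_eq_mul]

/-- Integrating the volumes of the sections `t = ⟪J y, p⟫` of `S` against a radial weight in `p`. -/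
theorem lintegral_volume_sections {V : Type*} [NormedAddCommGroup V] [InnerProductSpace ℝ V]
    [FiniteDimensional ℝ V] [Nontrivial V] [MeasurableSpace V] [BorelSpace V]
    (J : V →ₗᵢ[ℝ] Space) {w : ℝ → ℝ≥0∞} (hw : Measurable w) {f : ℝ → ℝ} (hf : Continuous f)
    (hwf : ∀ s, ∫⁻ t in Set.Ioi |s|, ENNReal.ofReal t * w t = ENNReal.ofReal (f |s|)⁻¹)
    {d : V × ℝ → ℝ≥0∞} (hdm : Measurable d)
    (hd : ∀ y : V, y ≠ 0 → ∀ t, d (y, t) = ENNReal.ofReal (‖y‖ * f |t / ‖y‖|)⁻¹)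
    {S : Set (V × ℝ)} (hS : MeasurableSet S) :
    ∫⁻ p : Space, w ‖p‖ * volume {y : V | (y, ⟪J y, p⟫) ∈ S}
      = ENNReal.ofReal (2 * Real.pi) * ∫⁻ q in S, d q := by
  have hind : Measurable (S.indicator (1 : V × ℝ → ℝ≥0∞)) := measurable_one.indicator hS
  have hJ : Measurable fun z : Space × V => (z.2, ⟪J z.2, z.1⟫) := by
    have hJc : Continuous J := J.continuous
    have : Continuous fun z : Space × V => (z.2, ⟪J z.2, z.1⟫) := by fun_prop
    exact this.measurable
  have hL : ∀ p : Space, w ‖p‖ * volume {y : V | (y, ⟪J y, p⟫) ∈ S}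
      = ∫⁻ y, w ‖p‖ * S.indicator (1 : V × ℝ → ℝ≥0∞) (y, ⟪J y, p⟫) := by
    intro p
    have hmp : Measurable fun y : V => (y, ⟪J y, p⟫) := hJ.comp (measurable_prodMk_left (x := p))
    have hms : MeasurableSet {y : V | (y, ⟪J y, p⟫) ∈ S} := hmp hS
    rw [lintegral_const_mul (f := fun y : V => S.indicator (1 : V × ℝ → ℝ≥0∞) (y, ⟪J y, p⟫)) _
      (hind.comp hmp), ← lintegral_indicator_one hms]
    rfl
  rw [lintegral_congr hL, lintegral_lintegral_swap
    (((by fun_prop : Measurable fun z : Space × V => w ‖z.1‖).mul (hind.comp hJ)).aemeasurable),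
    ← lintegral_indicator hS, Measure.volume_eq_prod,
    lintegral_prod _ (hdm.indicator hS).aemeasurable,
    ← lintegral_const_mul _ (hdm.indicator hS).lintegral_prod_right']
  refine lintegral_congr_ae ?_
  filter_upwards [compl_mem_ae_iff.2 (measure_singleton (0 : V))] with y hy
  have hy : y ≠ 0 := hy
  have hn : 0 < ‖y‖ := norm_pos_iff.2 hy
  have hφ : Measurable fun t => S.indicator (1 : V × ℝ → ℝ≥0∞) (y, t) :=
    hind.comp measurable_prodMk_left
  have he : ‖‖y‖⁻¹ • J y‖ = 1 := by
    rw [norm_smul, norm_inv, norm_norm, J.norm_map, inv_mul_cancel₀ hn.ne']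
  have hin : ∀ p : Space, ⟪J y, p⟫ = ‖y‖ * ⟪‖y‖⁻¹ • J y, p⟫ := by
    intro p
    rw [real_inner_smul_left, mul_inv_cancel_left₀ hn.ne']
  simp only [hin]
  rw [lintegral_radial_mul_inner hw
    (φ := fun s => S.indicator (1 : V × ℝ → ℝ≥0∞) (y, ‖y‖ * s))
    (hφ.comp (measurable_const_mul ‖y‖)) he]
  congr 1
  have hh : Measurable fun t => S.indicator (1 : V × ℝ → ℝ≥0∞) (y, t) *
      ENNReal.ofReal (f |t / ‖y‖|)⁻¹ := by
    have := hf.measurable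
    fun_prop
  calc ∫⁻ s, S.indicator (1 : V × ℝ → ℝ≥0∞) (y, ‖y‖ * s) *
          ∫⁻ t in Set.Ioi |s|, ENNReal.ofReal t * w t
      = ∫⁻ s, (fun t => S.indicator (1 : V × ℝ → ℝ≥0∞) (y, t) *
          ENNReal.ofReal (f |t / ‖y‖|)⁻¹) (‖y‖ * s) := by
        refine lintegral_congr fun s => ?_
        dsimp only
        rw [hwf, mul_div_cancel_left₀ _ hn.ne']
    _ = ∫⁻ t, S.indicator d (y, t) := by
        rw [lintegral_comp_mul_left_of_pos hh hn]
        refine lintegral_congr fun t => ?_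
        by_cases ht : (y, t) ∈ S
        · simp only [Set.indicator_of_mem ht, Pi.one_apply, one_mul]
          rw [hd y hy, ← ENNReal.ofReal_mul (inv_nonneg.2 hn.le), mul_inv]
        · simp [Set.indicator_of_notMem ht]

theorem exists_linearIsometry_of_finrank_le {V W : Type*} [NormedAddCommGroup V]
    [InnerProductSpace ℝ V] [FiniteDimensional ℝ V] [NormedAddCommGroup W]
    [InnerProductSpace ℝ W] [FiniteDimensional ℝ W]
    (h : Module.finrank ℝ V ≤ Module.finrank ℝ W) : Nonempty (V →ₗᵢ[ℝ] W) := by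
  let b := stdOrthonormalBasis ℝ V
  let c := stdOrthonormalBasis ℝ W
  let f : V →ₗ[ℝ] W := b.toBasis.constr ℝ (c ∘ Fin.castLE h)
  refine ⟨f.isometryOfOrthonormal (v := b.toBasis) (by simp) ?_⟩
  have hf : f ∘ b.toBasis = c ∘ Fin.castLE h := by
    ext i
    simp [f]
  rw [hf]
  exact c.orthonormal.comp _ (Fin.castLE_injective h)

/-- Additive Haar measures related by a linear equivalence differ by a constant. -/
theorem exists_smul_measure_preimage {V W : Type*} [NormedAddCommGroup V] [NormedSpace ℝ V]
    [FiniteDimensional ℝ V] [MeasurableSpace V] [BorelSpace V] [NormedAddCommGroup W]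
    [NormedSpace ℝ W] [MeasurableSpace W] [BorelSpace W]
    (L : V ≃L[ℝ] W) (μ : Measure V) [μ.IsAddHaarMeasure] (ν : Measure W) [ν.IsAddHaarMeasure] :
    ∃ c : ℝ≥0∞, c ≠ 0 ∧ c ≠ ∞ ∧ ∀ s : Set W, ν s = c * μ (L ⁻¹' s) := by
  have : FiniteDimensional ℝ W := L.toLinearEquiv.finiteDimensional
  have hh : (μ.map L).IsAddHaarMeasure := L.isAddHaarMeasure_map μ
  refine ⟨(ν.addHaarScalarFactor (μ.map L) : NNReal), ?_, ENNReal.coe_ne_top, fun s => ?_⟩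
  · exact ENNReal.coe_ne_zero.2 (Measure.addHaarScalarFactor_pos_of_isAddHaarMeasure _ _).ne'
  · have h1 : μ.map L s = μ (L ⁻¹' s) := L.toHomeomorph.toMeasurableEquiv.map_apply s
    conv_lhs => rw [Measure.isAddLeftInvariant_eq_smul ν (μ.map L)]
    rw [Measure.smul_apply, h1]
    rfl

/-- The hyperplane orthogonal to `u₀ - q` as a graph over the hyperplane orthogonal to `u₀`. -/
theorem exists_graph_equiv {X : Type*} [NormedAddCommGroup X] [InnerProductSpace ℝ X]
    [FiniteDimensional ℝ X] {u₀ : X} (hu : ‖u₀‖ = 1) (q : (ℝ ∙ u₀)ᗮ) :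
    ∃ L : (ℝ ∙ u₀)ᗮ ≃L[ℝ] (ℝ ∙ (u₀ - (q : X)))ᗮ, ∀ y, (L y : X) = y + ⟪y, q⟫ • u₀ := by
  have huu : ⟪u₀, u₀⟫ = 1 := by rw [real_inner_self_eq_norm_sq, hu, one_pow]
  have hV : ∀ y : (ℝ ∙ u₀)ᗮ, ⟪(y : X), u₀⟫ = 0 := fun y =>
    Submodule.mem_orthogonal_singleton_iff_inner_left.1 y.2
  let A : (ℝ ∙ u₀)ᗮ →ₗ[ℝ] X := (ℝ ∙ u₀)ᗮ.subtype +
    ((innerₗ (ℝ ∙ u₀)ᗮ).flip q).smulRight u₀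
  have hA : ∀ y, A y = y + ⟪y, q⟫ • u₀ := fun y => rfl
  have hmem : ∀ y, A y ∈ (ℝ ∙ (u₀ - (q : X)))ᗮ := by
    intro y
    have hq : ⟪u₀, (q : X)⟫ = 0 := by rw [real_inner_comm, hV]
    rw [Submodule.mem_orthogonal_singleton_iff_inner_left, hA, inner_sub_right, inner_add_left,
      inner_add_left, real_inner_smul_left, real_inner_smul_left, hV, huu, hq,
      Submodule.coe_inner]
    ring
  let B := A.codRestrict _ hmem
  have hB : Function.Bijective B := by
    constructor
    · rw [← LinearMap.ker_eq_bot, LinearMap.ker_eq_bot']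
      intro y hy
      have h0 : (y : X) + ⟪y, q⟫ • u₀ = 0 := congrArg Subtype.val hy
      have h1 := congrArg (fun x => ⟪x, u₀⟫) h0
      simp only [inner_add_left, real_inner_smul_left, hV, huu, inner_zero_left] at h1
      have h2 : ⟪y, q⟫ = 0 := by linarith
      rw [h2, zero_smul, add_zero] at h0
      exact Subtype.ext h0
    · rintro ⟨x, hx⟩
      rw [Submodule.mem_orthogonal_singleton_iff_inner_left, inner_sub_right] at hx
      have hy : x - ⟪x, u₀⟫ • u₀ ∈ (ℝ ∙ u₀)ᗮ := by
        rw [Submodule.mem_orthogonal_singleton_iff_inner_left, inner_sub_left,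
          real_inner_smul_left, huu]
        ring
      refine ⟨⟨_, hy⟩, Subtype.ext ?_⟩
      change x - ⟪x, u₀⟫ • u₀ + ⟪x - ⟪x, u₀⟫ • u₀, (q : X)⟫ • u₀ = x
      have h1 : ⟪x - ⟪x, u₀⟫ • u₀, (q : X)⟫ = ⟪x, u₀⟫ := by
        rw [inner_sub_left, real_inner_smul_left, real_inner_comm (q : X) u₀, hV]
        linarith
      rw [h1, sub_add_cancel]
  exact ⟨(LinearEquiv.ofBijective B hB).toContinuousLinearEquiv, fun y => rfl⟩

theorem exists_axis_equiv {X : Type*} [NormedAddCommGroup X] [InnerProductSpace ℝ X]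
    [FiniteDimensional ℝ X] {u₀ : X} (hu : ‖u₀‖ = 1) :
    ∃ L : ((ℝ ∙ u₀)ᗮ × ℝ) ≃L[ℝ] X, ∀ q, L q = q.1 + q.2 • u₀ := by
  have huu : ⟪u₀, u₀⟫ = 1 := by rw [real_inner_self_eq_norm_sq, hu, one_pow]
  have hV : ∀ y : (ℝ ∙ u₀)ᗮ, ⟪(y : X), u₀⟫ = 0 := fun y =>
    Submodule.mem_orthogonal_singleton_iff_inner_left.1 y.2
  let A : ((ℝ ∙ u₀)ᗮ × ℝ) →ₗ[ℝ] X :=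
    (ℝ ∙ u₀)ᗮ.subtype.coprod (LinearMap.toSpanSingleton ℝ X u₀)
  have hA : Function.Bijective A := by
    constructor
    · rw [← LinearMap.ker_eq_bot, LinearMap.ker_eq_bot']
      rintro ⟨y, t⟩ h0
      have h0 : (y : X) + t • u₀ = 0 := h0
      have h1 := congrArg (fun x => ⟪x, u₀⟫) h0
      simp only [inner_add_left, real_inner_smul_left, hV, huu, inner_zero_left] at h1
      have h2 : t = 0 := by linarith
      rw [h2, zero_smul, add_zero] at h0
      exact Prod.ext (Subtype.ext h0) h2
    · intro x
      have hy : x - ⟪x, u₀⟫ • u₀ ∈ (ℝ ∙ u₀)ᗮ := by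
        rw [Submodule.mem_orthogonal_singleton_iff_inner_left, inner_sub_left,
          real_inner_smul_left, huu]
        ring
      exact ⟨(⟨_, hy⟩, ⟪x, u₀⟫), sub_add_cancel _ _⟩
  exact ⟨(LinearEquiv.ofBijective A hA).toContinuousLinearEquiv, fun y => rfl⟩

/-- A comparison of central section areas gives a comparison of their projections along the
axis `u₀`. -/
theorem volume_graph_section_le {n : ℕ} {u₀ : E n} (hu : ‖u₀‖ = 1) {K₁ K₂ : Set (E n)}
    (hsec : ∀ u ∈ sphere (0 : E n) 1,
      μH[(n : ℝ) - 1] (K₁ ∩ hyperplane u) ≤ μH[(n : ℝ) - 1] (K₂ ∩ hyperplane u))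
    (q : (ℝ ∙ u₀)ᗮ) :
    volume {y : (ℝ ∙ u₀)ᗮ | (y : E n) + ⟪y, q⟫ • u₀ ∈ K₁}
      ≤ volume {y : (ℝ ∙ u₀)ᗮ | (y : E n) + ⟪y, q⟫ • u₀ ∈ K₂} := by
  set v : E n := u₀ - (q : E n) with hv
  have hv0 : v ≠ 0 := by
    intro h
    have h1 : ⟪v, u₀⟫ = 1 := by
      rw [hv, inner_sub_left, Submodule.mem_orthogonal_singleton_iff_inner_left.1 q.2,
        real_inner_self_eq_norm_sq, hu]
      norm_num
    rw [h, inner_zero_left] at h1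
    exact zero_ne_one h1
  have hfin : (Module.finrank ℝ (ℝ ∙ v)ᗮ : ℝ) = (n : ℝ) - 1 := by
    have h1 := (ℝ ∙ v).finrank_add_finrank_orthogonal
    rw [finrank_span_singleton hv0, finrank_euclideanSpace_fin] at h1
    have h2 : (1 : ℝ) + Module.finrank ℝ (ℝ ∙ v)ᗮ = n := mod_cast h1
    linarith
  obtain ⟨L, hL⟩ := exists_graph_equiv hu q
  obtain ⟨c, hc0, hct, hc⟩ := exists_smul_measure_preimage L volume
    (μH[(Module.finrank ℝ (ℝ ∙ v)ᗮ : ℝ)] : Measure (ℝ ∙ v)ᗮ)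
  have key : ∀ K : Set (E n), μH[(n : ℝ) - 1] (K ∩ hyperplane (‖v‖⁻¹ • v))
      = c * volume {y : (ℝ ∙ u₀)ᗮ | (y : E n) + ⟪y, q⟫ • u₀ ∈ K} := by
    intro K
    have hset : K ∩ hyperplane (‖v‖⁻¹ • v) = (↑) '' ((↑) ⁻¹' K : Set (ℝ ∙ v)ᗮ) := by
      ext x
      simp only [hyperplane, Set.mem_inter_iff, Set.mem_ofPred_eq, Set.mem_image, Set.mem_preimage,
        Subtype.exists, exists_and_right, exists_eq_right, exists_prop,
        Submodule.mem_orthogonal_singleton_iff_inner_left, real_inner_smul_right, mul_eq_zero,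
        inv_eq_zero, norm_eq_zero, hv0, false_or]
      exact and_comm
    rw [hset, ← hfin, isometry_subtype_coe.hausdorffMeasure_image (Or.inl (Nat.cast_nonneg _)), hc]
    congr 2
    ext y
    simp [hL]
  have h := hsec (‖v‖⁻¹ • v) (by simp [norm_smul, hv0])
  rw [key, key] at h
  exact (ENNReal.mul_le_mul_iff_right hc0 hct).1 h

theorem mem_nhds_zero_of_symmetric_convex {X : Type*} [NormedAddCommGroup X] [NormedSpace ℝ X]
    {K : Set X} (hc : Convex ℝ K) (hs : ∀ x, x ∈ K ↔ -x ∈ K) (hi : (interior K).Nonempty) :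
    K ∈ nhds (0 : X) := by
  obtain ⟨x, hx⟩ := hi
  have hK : -K = K := Set.ext fun y => (hs y).symm
  have hnx : -x ∈ interior K := by
    rw [← hK, ← Set.neg_preimage, ← Homeomorph.coe_neg, ← Homeomorph.preimage_interior]
    simpa using hx
  have := hc.interior hx hnx (a := 1 / 2) (b := 1 / 2) (by norm_num) (by norm_num) (by norm_num)
  rw [smul_neg, add_neg_cancel] at this
  exact mem_interior_iff_mem_nhds.1 this

theorem gauge_linearIsometryEquiv {X : Type*} [NormedAddCommGroup X] [InnerProductSpace ℝ X]
    {K : Set X} {R : X ≃ₗᵢ[ℝ] X} (hR : R '' K = K) (x : X) : gauge K (R x) = gauge K x := by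
  have h : ∀ z, R z ∈ K ↔ z ∈ K := fun z => by
    conv_lhs => rw [← hR]
    exact R.injective.mem_set_image
  simp only [gauge_def', ← map_smul, h]

/-- The gauge of a body of revolution depends only on the norm of the component orthogonal to the
axis. -/
theorem IsRevolutionBody.gauge_add_smul {n : ℕ} {u₀ : E n} {K : Set (E n)}
    (hK : IsRevolutionBody u₀ K) {y z : (ℝ ∙ u₀)ᗮ} (h : ‖y‖ = ‖z‖) (t : ℝ) :
    gauge K ((y : E n) + t • u₀) = gauge K ((z : E n) + t • u₀) := by
  have hR : (ℝ ∙ ((y : E n) - z))ᗮ.reflection (y : E n) = z := Submodule.reflection_sub h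
  have hu : (ℝ ∙ ((y : E n) - z))ᗮ.reflection u₀ = u₀ := by
    rw [Submodule.reflection_eq_self_iff, Submodule.mem_orthogonal_singleton_iff_inner_right]
    exact Submodule.mem_orthogonal_singleton_iff_inner_left.1 (y - z).2
  have h1 := gauge_linearIsometryEquiv (hK _ hu) ((y : E n) + t • u₀)
  rw [map_add, map_smul, hR, hu] at h1
  exact h1.symm

theorem setLIntegral_inv_gauge_ne_top {X : Type*} [NormedAddCommGroup X] [NormedSpace ℝ X]
    [FiniteDimensional ℝ X] [MeasurableSpace X] [BorelSpace X] (μ : Measure X)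
    [μ.IsAddHaarMeasure] (hdim : 2 ≤ Module.finrank ℝ X) {K : Set X}
    (hK : Bornology.IsBounded K) (h0 : K ∈ nhds (0 : X)) :
    ∫⁻ x in K, ENNReal.ofReal (gauge K x)⁻¹ ∂μ ≠ ∞ := by
  have : Nontrivial X := Module.nontrivial_of_finrank_pos (R := ℝ) (by omega)
  obtain ⟨R, hR0, hR⟩ := hK.subset_closedBall_lt 0 0
  have hle : ∀ x, (gauge K x)⁻¹ ≤ R * ‖x‖⁻¹ := by
    intro x
    rcases eq_or_ne x 0 with rfl | hx
    · simp
    have h1 := le_gauge_of_subset_closedBall (absorbent_nhds_zero h0) hR0.le hR (x := x)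
    have hx : 0 < ‖x‖ := norm_pos_iff.2 hx
    calc (gauge K x)⁻¹ ≤ (‖x‖ / R)⁻¹ := inv_anti₀ (by positivity) h1
      _ = R * ‖x‖⁻¹ := by rw [inv_div, div_eq_mul_inv]
  have hintr : IntegrableOn (fun x : X => R * ‖x‖⁻¹) (ball 0 (R + 1)) μ := by
    rw [integrableOn_fun_norm_addHaar μ (f := fun y => R * y⁻¹)]
    have hpow : IntegrableOn (fun y : ℝ => R * y ^ (Module.finrank ℝ X - 2)) (Set.Ioo 0 (R + 1)) :=
      ((by fun_prop : Continuous fun y : ℝ => R * y ^ (Module.finrank ℝ X - 2)).integrableOn_Icc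
        (a := 0) (b := R + 1)).mono_set Set.Ioo_subset_Icc_self
    refine hpow.congr_fun (fun y hy => ?_) measurableSet_Ioo
    have hy : y ≠ 0 := hy.1.ne'
    have hd : Module.finrank ℝ X - 1 = Module.finrank ℝ X - 2 + 1 := by omega
    rw [hd, pow_succ, smul_eq_mul]
    field_simp
  refine ne_top_of_le_ne_top hintr.lintegral_lt_top.ne ?_
  calc ∫⁻ x in K, ENNReal.ofReal (gauge K x)⁻¹ ∂μ
      ≤ ∫⁻ x in K, ENNReal.ofReal (R * ‖x‖⁻¹) ∂μ :=
        lintegral_mono fun x => ENNReal.ofReal_le_ofReal (hle x)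
    _ ≤ _ := lintegral_mono_set (hR.trans (closedBall_subset_ball (by linarith)))

/-- The profile of the gauge of a body of revolution in a half-plane through the axis. -/
theorem exists_gauge_profile {n : ℕ} {u₀ : E n} (hu : ‖u₀‖ = 1) [Nontrivial (ℝ ∙ u₀)ᗮ]
    {K : Set (E n)} (hcomp : IsCompact K) (hconv : Convex ℝ K) (hs : ∀ x, x ∈ K ↔ -x ∈ K)
    (h0 : K ∈ nhds (0 : E n)) (hrev : IsRevolutionBody u₀ K) :
    ∃ f : ℝ → ℝ, (∃ C, LipschitzWith C f) ∧ ConvexOn ℝ Set.univ f ∧ (∀ t, f (-t) = f t) ∧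
      0 < f 0 ∧ Filter.Tendsto f Filter.atTop Filter.atTop ∧
      ∀ y : (ℝ ∙ u₀)ᗮ, y ≠ 0 → ∀ t : ℝ, gauge K ((y : E n) + t • u₀) = ‖y‖ * f |t / ‖y‖| := by
  have hab : Absorbent ℝ K := absorbent_nhds_zero h0
  have hgpos : ∀ x : E n, x ≠ 0 → 0 < gauge K x := fun x hx =>
    (gauge_pos hab (NormedSpace.isVonNBounded_of_isBounded ℝ hcomp.isBounded)).2 hx
  obtain ⟨e, he⟩ := exists_norm_eq (ℝ ∙ u₀)ᗮ (zero_le_one' ℝ)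
  have he0 : (e : E n) ≠ 0 := by
    intro h
    rw [Submodule.coe_eq_zero] at h
    simp [h] at he
  have hu0 : u₀ ≠ 0 := by
    rintro rfl
    simp at hu
  have heven : ∀ t : ℝ, gauge K ((e : E n) + (-t) • u₀) = gauge K ((e : E n) + t • u₀) := by
    intro t
    rw [← gauge_neg (fun x hx => (hs x).1 hx), neg_add, neg_smul, neg_neg, ← Submodule.coe_neg]
    exact hrev.gauge_add_smul (norm_neg e) t
  refine ⟨fun t => gauge K ((e : E n) + t • u₀), ?_, ⟨convex_univ, ?_⟩, heven, ?_, ?_, ?_⟩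
  · obtain ⟨C, hC⟩ := hconv.lipschitz_gauge h0
    refine ⟨C * 1, hC.comp (LipschitzWith.of_dist_le_mul fun a b => ?_)⟩
    rw [dist_add_left, dist_eq_norm, ← sub_smul, norm_smul, hu, Real.dist_eq, Real.norm_eq_abs]
    simp
  · intro a _ b _ p q hp hq hpq
    have h : (e : E n) + (p • a + q • b) • u₀
        = p • ((e : E n) + a • u₀) + q • ((e : E n) + b • u₀) := by
      have h1 : (e : E n) = (p + q) • (e : E n) := by rw [hpq, one_smul]
      conv_lhs => rw [h1]
      module
    dsimp only
    rw [h, ← gauge_smul_of_nonneg hp, ← gauge_smul_of_nonneg hq]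
    exact gauge_add_le hconv hab _ _
  · simpa using hgpos _ he0
  · have hlow : ∀ t : ℝ, 0 ≤ t → gauge K u₀ * t - gauge K (-(e : E n))
        ≤ gauge K ((e : E n) + t • u₀) := by
      intro t ht
      have h1 := gauge_add_le hconv hab ((e : E n) + t • u₀) (-(e : E n))
      rw [add_neg_cancel_comm, gauge_smul_of_nonneg ht, smul_eq_mul] at h1
      linarith
    refine Filter.tendsto_atTop_mono' Filter.atTop
      (f₁ := fun t => gauge K u₀ * t - gauge K (-(e : E n))) ?_ ?_
    · filter_upwards [Filter.eventually_ge_atTop 0] with t ht using hlow t ht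
    · exact Filter.tendsto_atTop_add_const_right _ _
        (Filter.tendsto_id.const_mul_atTop (hgpos _ hu0))
  · intro y hy t
    have hn : 0 < ‖y‖ := norm_pos_iff.2 hy
    have h1 : gauge K ((e : E n) + |t / ‖y‖| • u₀) = gauge K ((e : E n) + (t / ‖y‖) • u₀) := by
      rcases abs_choice (t / ‖y‖) with h | h
      · rw [h]
      · rw [h, heven]
    have h2 : gauge K ((e : E n) + (t / ‖y‖) • u₀)
        = gauge K (((‖y‖⁻¹ • y : (ℝ ∙ u₀)ᗮ) : E n) + (t / ‖y‖) • u₀) :=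
      hrev.gauge_add_smul
        (by rw [he, norm_smul, norm_inv, norm_norm, inv_mul_cancel₀ hn.ne']) _
    dsimp only
    rw [h1, h2, ← smul_eq_mul, ← gauge_smul_of_nonneg hn.le, smul_add, Submodule.coe_smul,
      smul_inv_smul₀ hn.ne', smul_smul, mul_div_cancel₀ _ hn.ne']

theorem finrank_space : Module.finrank ℝ Space = 3 := by
  rw [(WithLp.linearEquiv 2 ℝ (ℝ × ℂ)).finrank_eq, Module.finrank_prod, Module.finrank_self,
    Complex.finrank_real_complex]

/-- In dimension 3 or 4, the Busemann–Petty problem has an affirmative answer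
whenever `K₁` is a centered convex body of revolution. -/
theorem busemann_petty_revolution (n : ℕ) (hn : n = 3 ∨ n = 4)
    (u₀ : E n) (hu₀ : u₀ ∈ sphere (0 : E n) 1) (K₁ K₂ : Set (E n))
    (hK₁ : IsConvexBody K₁) (hc₁ : IsCentered K₁) (hrev : IsRevolutionBody u₀ K₁)
    (hK₂ : IsConvexBody K₂) (hc₂ : IsCentered K₂)
    (hsec : ∀ u ∈ sphere (0 : E n) 1,
      μH[(n : ℝ) - 1] (K₁ ∩ hyperplane u) ≤ μH[(n : ℝ) - 1] (K₂ ∩ hyperplane u)) :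
    μH[(n : ℝ)] K₁ ≤ μH[(n : ℝ)] K₂ := by
  obtain ⟨hcomp, hconv, hintr⟩ := hK₁
  have hu : ‖u₀‖ = 1 := mem_sphere_zero_iff_norm.1 hu₀
  have hu0 : u₀ ≠ 0 := by
    rintro rfl
    simp at hu
  have h0 : K₁ ∈ nhds (0 : E n) := mem_nhds_zero_of_symmetric_convex hconv hc₁ hintr
  have hfin : 1 + Module.finrank ℝ (ℝ ∙ u₀)ᗮ = n := by
    have h1 := (ℝ ∙ u₀).finrank_add_finrank_orthogonal
    rwa [finrank_span_singleton hu0, finrank_euclideanSpace_fin] at h1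
  have hnt : Nontrivial (ℝ ∙ u₀)ᗮ := Module.nontrivial_of_finrank_pos (R := ℝ) (by omega)
  obtain ⟨J⟩ := exists_linearIsometry_of_finrank_le (V := (ℝ ∙ u₀)ᗮ) (W := Space)
    (by rw [finrank_space]; omega)
  obtain ⟨f, ⟨C, hL⟩, hfc, hfe, hf0, hflim, hgf⟩ :=
    exists_gauge_profile hu hcomp hconv hc₁ h0 hrev
  obtain ⟨w, hw, hwf⟩ := exists_radial_weight hL hfc hfe hf0 hflim
  obtain ⟨L, hLa⟩ := exists_axis_equiv hu
  have hgm : Measurable fun x => ENNReal.ofReal (gauge K₁ x)⁻¹ := by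
    have := (continuous_gauge hconv h0).measurable
    fun_prop
  have hLm : Measurable L := L.continuous.measurable
  set d : (ℝ ∙ u₀)ᗮ × ℝ → ℝ≥0∞ := fun q => ENNReal.ofReal (gauge K₁ (L q))⁻¹ with hd
  have hdm : Measurable d := hgm.comp hLm
  have hm₁ : MeasurableSet (L ⁻¹' K₁) := hLm hcomp.measurableSet
  have hm₂ : MeasurableSet (L ⁻¹' K₂) := hLm hK₂.1.measurableSet
  have hdf : ∀ y : (ℝ ∙ u₀)ᗮ, y ≠ 0 → ∀ t, d (y, t) = ENNReal.ofReal (‖y‖ * f |t / ‖y‖|)⁻¹ := by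
    intro y hy t
    rw [hd, ← hgf y hy t]
    simp only [hLa]
  have hset : ∀ (K : Set (E n)) (p : Space),
      {y : (ℝ ∙ u₀)ᗮ | (y, ⟪J y, p⟫) ∈ L ⁻¹' K}
        = {y : (ℝ ∙ u₀)ᗮ | (y : E n) + ⟪y, J.toLinearMap.adjoint p⟫ • u₀ ∈ K} := by
    intro K p
    ext y
    simp [hLa, LinearMap.adjoint_inner_right]
  have hle : ∫⁻ q in L ⁻¹' K₁, d q ≤ ∫⁻ q in L ⁻¹' K₂, d q := by
    have h1 := lintegral_volume_sections J hw hL.continuous hwf hdm hdf hm₁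
    have h2 := lintegral_volume_sections J hw hL.continuous hwf hdm hdf hm₂
    have hpi : ENNReal.ofReal (2 * Real.pi) ≠ 0 :=
      (ENNReal.ofReal_pos.2 Real.two_pi_pos).ne'
    rw [← ENNReal.mul_le_mul_iff_right hpi ENNReal.ofReal_ne_top, ← h1, ← h2]
    refine lintegral_mono fun p => mul_le_mul_right ?_ _
    rw [hset, hset]
    exact volume_graph_section_le hu hsec _
  have hHaar : (volume : Measure ((ℝ ∙ u₀)ᗮ × ℝ)).IsAddHaarMeasure :=
    Measure.prod.instIsAddHaarMeasure _ _
  have hfinite : ∫⁻ q in L ⁻¹' K₁, d q ≠ ∞ := by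
    have := L.isAddHaarMeasure_map (volume : Measure ((ℝ ∙ u₀)ᗮ × ℝ))
    have h1 := setLIntegral_inv_gauge_ne_top
      (Measure.map L (volume : Measure ((ℝ ∙ u₀)ᗮ × ℝ)))
      (by rw [finrank_euclideanSpace_fin]; omega) hcomp.isBounded h0
    rwa [setLIntegral_map hcomp.measurableSet hgm hLm] at h1
  have hvol : volume (L ⁻¹' K₁) ≤ volume (L ⁻¹' K₂) := by
    have hsing : MeasurableSet ({0} : Set ((ℝ ∙ u₀)ᗮ × ℝ)) := measurableSet_singleton 0
    have hz : volume ({0} : Set ((ℝ ∙ u₀)ᗮ × ℝ)) = 0 := measure_singleton 0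
    have hsub : ∫⁻ q in L ⁻¹' K₁ \ {0}, d q ≤ ∫⁻ q in L ⁻¹' K₁, d q :=
      lintegral_mono_set Set.sdiff_subset
    rw [← measure_sdiff_null hz]
    refine measure_le_of_setLIntegral_le (hm₁.diff hsing) hm₂ (fun q hq => ?_) (fun q hq => ?_)
      (ne_top_of_le_ne_top hfinite hsub) (hsub.trans hle)
    · have hq0 : L q ≠ 0 := fun h => hq.2 (L.map_eq_zero_iff.1 h)
      have hpos : 0 < gauge K₁ (L q) :=
        (gauge_pos (absorbent_nhds_zero h0) (NormedSpace.isVonNBounded_of_isBounded ℝ hcomp.isBounded)).2 hq0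
      exact ENNReal.one_le_ofReal.2 ((one_le_inv₀ hpos).2 (gauge_le_one_of_mem hq.1))
    · refine ENNReal.ofReal_le_one.2 ?_
      rcases eq_or_ne q 0 with rfl | hq0
      · simp
      · have hqK : L q ∉ K₁ := fun h => hq ⟨h, hq0⟩
        exact inv_le_one_of_one_le₀ (one_le_gauge_of_notMem
          (hconv.starConvex (mem_of_mem_nhds h0)) (absorbent_nhds_zero h0).absorbs hqK)
  have hH : (μH[(n : ℝ)] : Measure (E n)).IsAddHaarMeasure := by
    have := isAddHaarMeasure_hausdorffMeasure (E := E n)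
    rwa [finrank_euclideanSpace_fin] at this
  obtain ⟨c, -, -, hc⟩ := exists_smul_measure_preimage L volume (μH[(n : ℝ)] : Measure (E n))
  rw [hc, hc]
  gcongr
end
end
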